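/- arXiv:2210.07139 — 5 statements merged into one kernel-verified Lean document; each statement's English description precedes it below -/
import Mathlib

section
/- Let G be a finite simple connected graph of diameter d with adjacency matrix A. Then G is distance-regular if and only if A has exactly d+1 distinct eigenvalues and there exists a real polynomial p of degree d such that p(A) = A_d. -/
open Polynomial Matrix

/-- The distance-`i` matrix of a graph: `(A_i)_{u,v} = 1` if `d(u,v) = i` and `0` otherwise. -/
noncomputable def distMatrix {V : Type*} [Fintype V] (G : SimpleGraph V) (i : ℕ) :
    Matrix V V ℝ :=
  Matrix.of fun u v => if G.dist u v = i then 1 else 0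

/-- `G` has diameter `d`. -/
def IsDiam {V : Type*} (G : SimpleGraph V) (d : ℕ) : Prop :=
  (∀ u v, G.dist u v ≤ d) ∧ ∃ u v, G.dist u v = d

/-- `G`, of diameter `d` and with adjacency matrix `A`, is distance-regular:
`A` has exactly `d+1` distinct eigenvalues and each distance matrix `A_i` is a polynomial
of degree `i` in `A`. -/
def IsDistRegular {V : Type*} [Fintype V] [DecidableEq V] (G : SimpleGraph V)
    (A : Matrix V V ℝ) (d : ℕ) : Prop :=
  (spectrum ℝ A).ncard = d + 1 ∧
    ∀ i ≤ d, ∃ p : Polynomial ℝ, p.degree = (i : WithBot ℕ) ∧ aeval A p = distMatrix G i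

/-- The matrices that are values at `A` of polynomials of degree less than `n`. -/
noncomputable def polySpan {V : Type*} [Fintype V] [DecidableEq V] (A : Matrix V V ℝ) (n : ℕ) :
    Submodule ℝ (Matrix V V ℝ) :=
  (degreeLT ℝ n).map (aeval A).toLinearMap

section PolySpan

variable {V : Type*} [Fintype V] [DecidableEq V] {A M N : Matrix V V ℝ} {n : ℕ}

lemma mem_polySpan : M ∈ polySpan A n ↔ ∃ p : ℝ[X], p.degree < n ∧ aeval A p = M := by
  simp [polySpan, mem_degreeLT]

lemma polySpan_mono {m : ℕ} (h : m ≤ n) : polySpan A m ≤ polySpan A n :=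
  Submodule.map_mono (degreeLT_mono h)

lemma exists_sub_smul_mem_polySpan (hM : M ∈ polySpan A (n + 1)) (hN : N ∈ polySpan A (n + 1))
    (hN' : N ∉ polySpan A n) : ∃ c : ℝ, M - c • N ∈ polySpan A n := by
  obtain ⟨p, hp, rfl⟩ := mem_polySpan.1 hM
  obtain ⟨q, hq, rfl⟩ := mem_polySpan.1 hN
  have hq0 : q.coeff n ≠ 0 := by
    intro h
    refine hN' (mem_polySpan.2 ⟨q, ?_, rfl⟩)
    rw [degree_lt_iff_coeff_zero] at hq ⊢
    intro m hm
    rcases hm.eq_or_lt with rfl | hm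
    · exact h
    · exact hq m hm
  refine ⟨p.coeff n / q.coeff n, mem_polySpan.2 ⟨p - (p.coeff n / q.coeff n) • q, ?_, by simp⟩⟩
  rw [degree_lt_iff_coeff_zero] at hp hq ⊢
  intro m hm
  rcases hm.eq_or_lt with rfl | hm
  · simp [hq0]
  · simp [hp m hm, hq m hm]

lemma aeval_mem_polySpan_ncard_spectrum (hA : A.IsHermitian) (p : ℝ[X]) :
    aeval A p ∈ polySpan A (spectrum ℝ A).ncard := by
  have hfin : (spectrum ℝ A).Finite := Matrix.finite_real_spectrum
  set q : ℝ[X] := ∏ t ∈ hfin.toFinset, (X - C t) with hq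
  have hmonic : q.Monic := monic_prod_of_monic _ _ fun t _ => monic_X_sub_C t
  have hdeg : q.degree = ((spectrum ℝ A).ncard : WithBot ℕ) := by
    rw [hq, degree_prod, Set.ncard_eq_toFinset_card _ hfin]
    simp
  have hroot : aeval A q = 0 := by
    have hs : IsSelfAdjoint A := hA
    rw [← cfc_polynomial q A hs, ← cfc_zero ℝ A]
    refine cfc_congr fun t ht => ?_
    simp only [hq, eval_prod, Pi.zero_apply]
    exact Finset.prod_eq_zero (hfin.mem_toFinset.2 ht) (by simp)
  exact mem_polySpan.2 ⟨p %ₘ q, hdeg ▸ degree_modByMonic_lt p hmonic,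
    aeval_modByMonic_eq_self_of_root hroot⟩

end PolySpan

section Graph

variable {V : Type*} [Fintype V] {G : SimpleGraph V} {d : ℕ}

lemma distMatrix_hadamard_apply (i : ℕ) (M : Matrix V V ℝ) (u v : V) :
    (distMatrix G i ⊙ M) u v = if G.dist u v = i then M u v else 0 := by
  simp [distMatrix, hadamard]

lemma SimpleGraph.Connected.exists_adj_dist_eq {V : Type*} {G : SimpleGraph V}
    (hconn : G.Connected) {u v : V} {k : ℕ} (h : G.dist u v = k + 1) :
    ∃ w, G.Adj u w ∧ G.dist w v = k := by
  obtain ⟨p, hp⟩ := hconn.exists_walk_length_eq_dist u v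
  cases p with
  | nil => simp at h
  | @cons _ w _ hadj p =>
    refine ⟨w, hadj, ?_⟩
    have h1 := SimpleGraph.dist_le p
    have h2 := hconn.dist_triangle (u := u) (v := w) (w := v)
    rw [SimpleGraph.dist_eq_one_iff_adj.2 hadj] at h2
    rw [SimpleGraph.Walk.length_cons] at hp
    omega

lemma IsDiam.exists_dist_eq {V : Type*} {G : SimpleGraph V} {d : ℕ} (hd : IsDiam G d) (hconn : G.Connected) {i : ℕ} (hi : i ≤ d) :
    ∃ u v, G.dist u v = i := by
  induction hi using Nat.decreasingInduction with
  | self => exact hd.2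
  | of_succ k hk ih =>
    obtain ⟨u, v, h⟩ := ih
    obtain ⟨w, -, hw⟩ := hconn.exists_adj_dist_eq h
    exact ⟨w, v, hw⟩

variable [DecidableEq V] [DecidableRel G.Adj] {H M : Matrix V V ℝ}

lemma apply_eq_zero_of_mem_polySpan {n : ℕ} (hM : M ∈ polySpan (G.adjMatrix ℝ) n) {u v : V}
    (h : n ≤ G.dist u v) : M u v = 0 := by
  obtain ⟨p, hp, rfl⟩ := mem_polySpan.1 hM
  rw [aeval_eq_sum_range, Matrix.sum_apply]
  refine Finset.sum_eq_zero fun i _ => ?_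
  rcases lt_or_ge i n with hi | hi
  · rw [Matrix.smul_apply, SimpleGraph.adjMatrix_pow_apply_eq_card_walk]
    have : IsEmpty {p : G.Walk u v | p.length = i} :=
      ⟨fun ⟨p, (hp : p.length = i)⟩ => by have := SimpleGraph.dist_le p; omega⟩
    simp [Fintype.card_eq_zero]
  · rw [(degree_lt_iff_coeff_zero _ _).1 hp i hi, zero_smul, Matrix.zero_apply]

/-- A matrix in the adjacency algebra can be reduced to a polynomial in `A` of degree less than `k`
without changing its entries at distance less than `k`. -/
lemma exists_mem_polySpan_eq_of_dist_lt (hconn : G.Connected) (hd : IsDiam G d)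
    (hH : ∀ u v, 0 < H u v) {k : ℕ} (hk : k ≤ d + 1)
    (hD : ∀ j, k ≤ j → j ≤ d → distMatrix G j ⊙ H ∈ polySpan (G.adjMatrix ℝ) (j + 1))
    (hM : M ∈ polySpan (G.adjMatrix ℝ) (d + 1)) :
    ∃ N ∈ polySpan (G.adjMatrix ℝ) k, ∀ u v, G.dist u v < k → N u v = M u v := by
  induction hk using Nat.decreasingInduction with
  | self => exact ⟨M, hM, fun _ _ _ => rfl⟩
  | of_succ k hk ih =>
    obtain ⟨N, hN, hNM⟩ := ih fun j hj => hD j (by omega)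
    obtain ⟨u, v, huv⟩ := hd.exists_dist_eq hconn (Nat.lt_succ_iff.1 hk)
    have hnot : distMatrix G k ⊙ H ∉ polySpan (G.adjMatrix ℝ) k := fun hmem => by
      have := apply_eq_zero_of_mem_polySpan hmem huv.ge
      rw [distMatrix_hadamard_apply, if_pos huv] at this
      exact (hH u v).ne' this
    obtain ⟨c, hc⟩ := exists_sub_smul_mem_polySpan hN (hD k le_rfl (Nat.lt_succ_iff.1 hk)) hnot
    refine ⟨_, hc, fun u v h => ?_⟩
    rw [Matrix.sub_apply, Matrix.smul_apply, distMatrix_hadamard_apply, if_neg h.ne,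
      hNM u v (h.trans k.lt_succ_self), smul_zero, sub_zero]

/-- If `A_d` is a polynomial in `A`, then for every entrywise positive `H` in the adjacency
algebra the restriction of `H` to the pairs at distance `i` is a polynomial in `A` of degree at
most `i`. -/
lemma distMatrix_hadamard_mem_polySpan (hconn : G.Connected) (hd : IsDiam G d)
    (hspec : (spectrum ℝ (G.adjMatrix ℝ)).ncard = d + 1) {p : ℝ[X]}
    (hp : aeval (G.adjMatrix ℝ) p = distMatrix G d) {h : ℝ[X]}
    (hh : aeval (G.adjMatrix ℝ) h = H) (hH : ∀ u v, 0 < H u v) {i : ℕ} (hi : i ≤ d) :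
    distMatrix G i ⊙ H ∈ polySpan (G.adjMatrix ℝ) (i + 1) := by
  have hall (r : ℝ[X]) : aeval (G.adjMatrix ℝ) r ∈ polySpan (G.adjMatrix ℝ) (d + 1) :=
    hspec ▸ aeval_mem_polySpan_ncard_spectrum (G.isHermitian_adjMatrix ℝ) r
  have hHmem : H ∈ polySpan (G.adjMatrix ℝ) (d + 1) := hh ▸ hall h
  suffices hD : ∀ j, i ≤ j → j ≤ d → distMatrix G j ⊙ H ∈ polySpan (G.adjMatrix ℝ) (j + 1) from
    hD i le_rfl hi
  induction hi using Nat.decreasingInduction with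
  | self =>
    intro j hj hj'
    obtain rfl := le_antisymm hj hj'
    have hAd : distMatrix G d ∈ polySpan (G.adjMatrix ℝ) (d + 1) := hp ▸ hall p
    obtain ⟨x, y, hxy⟩ := hd.2
    obtain ⟨c, hc⟩ := exists_sub_smul_mem_polySpan hHmem hAd fun hmem => by
      simpa [distMatrix, hxy] using apply_eq_zero_of_mem_polySpan hmem hxy.ge
    convert Submodule.smul_mem _ c hAd using 1
    ext u v
    rw [distMatrix_hadamard_apply]
    split_ifs with huv
    · have := apply_eq_zero_of_mem_polySpan hc huv.ge
      simp only [Matrix.sub_apply, Matrix.smul_apply] at this ⊢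
      linarith
    · simp [distMatrix, huv]
  | of_succ m hm ih =>
    intro j hj hj'
    rcases hj.eq_or_lt with rfl | hj
    swap
    · exact ih j hj hj'
    set D := distMatrix G (m + 1) ⊙ H with hDdef
    obtain ⟨r, -, hr⟩ := mem_polySpan.1 (ih (m + 1) le_rfl hm)
    have hAD : G.adjMatrix ℝ * D ∈ polySpan (G.adjMatrix ℝ) (d + 1) := by
      have hXr := hall (X * r)
      rwa [map_mul, aeval_X, hr, ← hDdef] at hXr
    obtain ⟨B, hB, hBeq⟩ :=
      exists_mem_polySpan_eq_of_dist_lt hconn hd hH (Nat.succ_le_succ hm.le) ih hAD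
    obtain ⟨N, hN, hNeq⟩ :=
      exists_mem_polySpan_eq_of_dist_lt hconn hd hH (Nat.succ_le_succ hm.le) ih hHmem
    have hDnn (u v : V) : 0 ≤ D u v := by
      rw [hDdef, distMatrix_hadamard_apply]
      split_ifs
      exacts [(hH u v).le, le_rfl]
    have hB_not : B ∉ polySpan (G.adjMatrix ℝ) m := fun hmem => by
      obtain ⟨w, v, hwv⟩ := hd.exists_dist_eq hconn (show m + 1 ≤ d from hm)
      obtain ⟨u, hadj, huv⟩ := hconn.exists_adj_dist_eq hwv
      have h0 := apply_eq_zero_of_mem_polySpan hmem huv.ge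
      rw [hBeq u v (by omega), SimpleGraph.adjMatrix_mul_apply] at h0
      have h1 := (Finset.sum_eq_zero_iff_of_nonneg fun x _ => hDnn x v).1 h0 w
        (by simpa using hadj.symm)
      rw [hDdef, distMatrix_hadamard_apply, if_pos hwv] at h1
      exact (hH w v).ne' h1
    obtain ⟨c, hc⟩ := exists_sub_smul_mem_polySpan hN hB hB_not
    convert Submodule.smul_mem _ c hB using 1
    ext u v
    rw [distMatrix_hadamard_apply, Matrix.smul_apply]
    rcases lt_trichotomy (G.dist u v) m with huv | huv | huv
    · rw [if_neg huv.ne, hBeq u v (by omega), SimpleGraph.adjMatrix_mul_apply,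
        Finset.sum_eq_zero, smul_zero]
      intro w hw
      have hadj : G.Adj u w := by simpa using hw
      have htri := hconn.dist_triangle (u := w) (v := u) (w := v)
      rw [SimpleGraph.dist_eq_one_iff_adj.2 hadj.symm] at htri
      rw [hDdef, distMatrix_hadamard_apply, if_neg (by omega)]
    · rw [if_pos huv]
      have := apply_eq_zero_of_mem_polySpan hc huv.ge
      rw [Matrix.sub_apply, Matrix.smul_apply, hNeq u v (by omega)] at this
      linarith
    · rw [if_neg huv.ne', apply_eq_zero_of_mem_polySpan hB (by omega), smul_zero]

/-- The all-ones matrix of a connected regular graph is a polynomial in the adjacency matrix. -/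
lemma SimpleGraph.IsRegularOfDegree.exists_aeval_adjMatrix_eq_one {k : ℕ}
    (hreg : G.IsRegularOfDegree k) (hconn : G.Connected) :
    ∃ p : ℝ[X], aeval (G.adjMatrix ℝ) p = Matrix.of fun _ _ => 1 := by
  set A := G.adjMatrix ℝ with hA
  have hint : IsIntegral ℝ A := Matrix.isIntegral A
  have hev (p : ℝ[X]) : aeval A p *ᵥ (fun _ => 1) = fun _ => p.eval (k : ℝ) := by
    induction p using Polynomial.induction_on' with
    | add p q hp hq => ext v; simp [add_mulVec, hp, hq]
    | monomial n a =>
      induction n with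
      | zero => ext v; simp [Algebra.algebraMap_eq_smul_one, smul_mulVec]
      | succ n ih =>
        have : aeval A (monomial (n + 1) a) = aeval A (monomial n a) * A := by
          simp [aeval_monomial, pow_succ, mul_assoc]
        have h1 : A *ᵥ (fun _ => 1) = (k : ℝ) • fun _ => (1 : ℝ) := by
          ext v; simp [hA, SimpleGraph.adjMatrix_mulVec_apply, hreg v]
        rw [this, ← mulVec_mulVec, h1, mulVec_smul, ih]
        ext v
        simp [pow_succ]
        ring
  obtain ⟨v₀⟩ := hconn.nonempty
  have hroot : (minpoly ℝ A).IsRoot k := by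
    have := congrFun (hev (minpoly ℝ A)) v₀
    simpa using this.symm
  obtain ⟨r, hr⟩ := dvd_iff_isRoot.2 hroot
  have hmin := minpoly.monic hint
  have hr0 : r ≠ 0 := by
    rintro rfl
    exact hmin.ne_zero (by simpa using hr)
  have hrmonic : r.Monic := (monic_X_sub_C (k : ℝ)).of_mul_monic_left (hr ▸ hmin)
  have hne : aeval A r ≠ 0 :=
    minpoly.aeval_ne_zero_of_dvdNotUnit_minpoly hint hrmonic
      ⟨hr0, X - C (k : ℝ), not_isUnit_X_sub_C _, by rw [hr, mul_comm]⟩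
  set M := aeval A r with hM
  have hAM : A * M = (k : ℝ) • M := by
    have := minpoly.aeval ℝ A
    rw [hr, map_mul, map_sub, aeval_X, aeval_C, sub_mul, sub_eq_zero, ← hM] at this
    rw [this, Algebra.smul_def]
  have hsymm : Mᵀ = M := by
    have : Aᵀ = A := G.transpose_adjMatrix
    rw [hM, aeval_eq_sum_range, transpose_sum]
    simp [transpose_pow, this]
  have hcol (u u' v : V) : M u v = M u' v := by
    have hker : G.lapMatrix ℝ *ᵥ (fun x => M x v) = 0 := by
      ext x
      have := congrFun (congrFun hAM x) v
      rw [SimpleGraph.adjMatrix_mul_apply] at this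
      rw [SimpleGraph.lapMatrix_mulVec_apply, this, hreg x]
      simp
    exact (G.lapMatrix_mulVec_eq_zero_iff_forall_reachable).1 hker u u'
      (hconn.preconnected u u')
  have hconst (u v : V) : M u v = M v₀ v₀ := by
    rw [hcol u v₀ v, ← congrFun (congrFun hsymm v₀) v, transpose_apply, hcol v v₀ v₀]
  have hc : M v₀ v₀ ≠ 0 := fun h => hne (by ext u v; rw [hconst u v, h, Matrix.zero_apply])
  refine ⟨C (M v₀ v₀)⁻¹ * r, ?_⟩
  ext u v
  rw [map_mul, aeval_C, ← Algebra.smul_def, ← hM, Matrix.smul_apply, hconst u v]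
  simp [hc]

lemma isRegularOfDegree_of_aeval_adjMatrix_eq_distMatrix (hconn : G.Connected) (hd : IsDiam G d)
    (hspec : (spectrum ℝ (G.adjMatrix ℝ)).ncard = d + 1) {p : ℝ[X]}
    (hp : aeval (G.adjMatrix ℝ) p = distMatrix G d) : ∃ k, G.IsRegularOfDegree k := by
  have hpos (u v : V) : 0 < (∑ i ∈ Finset.range (d + 1), G.adjMatrix ℝ ^ i) u v := by
    rw [Matrix.sum_apply]
    refine Finset.sum_pos' (fun i _ => ?_)
      ⟨G.dist u v, Finset.mem_range.2 (Nat.lt_succ_iff.2 (hd.1 u v)), ?_⟩ <;>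
      rw [SimpleGraph.adjMatrix_pow_apply_eq_card_walk]
    · positivity
    · obtain ⟨w, hw⟩ := hconn.exists_walk_length_eq_dist u v
      exact Nat.cast_pos.2 (Fintype.card_pos_iff.2 ⟨⟨w, hw⟩⟩)
  have hsq : G.adjMatrix ℝ * G.adjMatrix ℝ ∈ polySpan (G.adjMatrix ℝ) (d + 1) := by
    have hXX := aeval_mem_polySpan_ncard_spectrum (G.isHermitian_adjMatrix ℝ) (X * X)
    rwa [map_mul, aeval_X, hspec] at hXX
  obtain ⟨N, hN, hNeq⟩ := exists_mem_polySpan_eq_of_dist_lt hconn hd hpos (Nat.le_add_left 1 d)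
    (fun j _ hj => distMatrix_hadamard_mem_polySpan hconn hd hspec hp
      (h := ∑ i ∈ Finset.range (d + 1), X ^ i) (by simp) hpos hj) hsq
  obtain ⟨q, hq, rfl⟩ := mem_polySpan.1 hN
  have hqC : q = C (q.coeff 0) := eq_C_of_degree_le_zero (Nat.WithBot.lt_one_iff_le_zero.1 hq)
  obtain ⟨v₀⟩ := hconn.nonempty
  have hdeg (v : V) : (G.degree v : ℝ) = q.coeff 0 := by
    rw [← SimpleGraph.adjMatrix_mul_self_apply_self, ← hNeq v v (by simp), hqC]
    simp [Matrix.algebraMap_matrix_apply]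
  exact ⟨G.degree v₀, fun v => by exact_mod_cast (hdeg v).trans (hdeg v₀).symm⟩

end Graph

theorem distance_regular_iff_diametral_polynomial
    {V : Type*} [Fintype V] [DecidableEq V] (G : SimpleGraph V) [DecidableRel G.Adj]
    (hconn : G.Connected) (d : ℕ) (hd : IsDiam G d) :
    IsDistRegular G (G.adjMatrix ℝ) d ↔
      (spectrum ℝ (G.adjMatrix ℝ)).ncard = d + 1 ∧
        ∃ p : Polynomial ℝ, p.degree = (d : WithBot ℕ) ∧
          aeval (G.adjMatrix ℝ) p = distMatrix G d := by
  refine ⟨fun h => ⟨h.1, h.2 d le_rfl⟩, ?_⟩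
  rintro ⟨hspec, p, -, hp⟩
  refine ⟨hspec, fun i hi => ?_⟩
  obtain ⟨k, hreg⟩ := isRegularOfDegree_of_aeval_adjMatrix_eq_distMatrix hconn hd hspec hp
  obtain ⟨h, hh⟩ := hreg.exists_aeval_adjMatrix_eq_one hconn
  have hmem := distMatrix_hadamard_mem_polySpan hconn hd hspec hp hh (by simp) hi
  have hone : (distMatrix G i ⊙ of fun _ _ => 1) = distMatrix G i := by ext; simp [hadamard]
  rw [hone] at hmem
  obtain ⟨q, hq, hqi⟩ := mem_polySpan.1 hmem
  refine ⟨q, le_antisymm (Order.lt_succ_iff.1 hq) (not_lt.1 fun hlt => ?_), hqi⟩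
  obtain ⟨u, v, huv⟩ := hd.exists_dist_eq hconn hi
  simpa [distMatrix, huv] using
    apply_eq_zero_of_mem_polySpan (mem_polySpan.2 ⟨q, hlt, hqi⟩) huv.ge
end

section
/- Let G be a finite simple connected bipartite graph with bipartition (B,C), adjacency matrix A, and diameter d. Then G is distance-biregular if and only if A has exactly d+1 distinct eigenvalues and there exist real polynomials p^B and p^C, each of degree d, such that p^B(A) e_b = A_d e_b for every b ∈ B and p^C(A) e_c = A_d e_c for every c ∈ C. -/
open Polynomial Matrix

/-- `(B, C)` is a bipartition of `G`: the two parts cover all vertices, are disjoint, and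
every edge joins a vertex of `B` to a vertex of `C`. -/
def IsBipartition {V : Type*} (G : SimpleGraph V) (B C : Finset V) : Prop :=
  (∀ v, v ∈ B ∨ v ∈ C) ∧ (∀ v, ¬(v ∈ B ∧ v ∈ C)) ∧
    ∀ u v, G.Adj u v → ((u ∈ B ∧ v ∈ C) ∨ (u ∈ C ∧ v ∈ B))

/-- A connected bipartite graph `G` with bipartition `(B,C)`, adjacency matrix `A`, and
diameter `d` is distance-biregular: `A` has exactly `d+1` distinct eigenvalues and there are
polynomials `p_i^B`, `p_i^C` of degree `i` with `p_i^B(A) e_b = A_i e_b` for all `b ∈ B` and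
`p_i^C(A) e_c = A_i e_c` for all `c ∈ C`, for `0 ≤ i ≤ d`. -/
def IsDistBiregular {V : Type*} [Fintype V] [DecidableEq V] (G : SimpleGraph V)
    (A : Matrix V V ℝ) (B C : Finset V) (d : ℕ) : Prop :=
  (spectrum ℝ A).ncard = d + 1 ∧
    ∃ pB pC : ℕ → Polynomial ℝ, ∀ i ≤ d,
      (pB i).degree = (i : WithBot ℕ) ∧ (pC i).degree = (i : WithBot ℕ) ∧
      (∀ b ∈ B, aeval A (pB i) *ᵥ Pi.single b 1 = distMatrix G i *ᵥ Pi.single b 1) ∧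
      (∀ c ∈ C, aeval A (pC i) *ᵥ Pi.single c 1 = distMatrix G i *ᵥ Pi.single c 1)

namespace SimpleGraph

variable {V : Type*} {G : SimpleGraph V}

theorem Connected.exists_dist_eq (hG : G.Connected) {x y : V} {j : ℕ} (hj : j ≤ G.dist y x) :
    ∃ v, G.dist v x = j ∧ G.dist y v + j = G.dist y x := by
  obtain ⟨p, hp⟩ := hG.exists_walk_length_eq_dist y x
  have h₁ := dist_le (p.take (G.dist y x - j))
  have h₂ := dist_le (p.drop (G.dist y x - j))
  rw [Walk.take_length] at h₁
  rw [Walk.drop_length] at h₂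
  have h₃ := hG.dist_triangle (u := y) (v := p.getVert (G.dist y x - j)) (w := x)
  exact ⟨p.getVert (G.dist y x - j), by omega, by omega⟩

variable [Fintype V] [DecidableEq V] [DecidableRel G.Adj]

theorem adjMatrix_pow_apply_nonneg (n : ℕ) (u v : V) : 0 ≤ (G.adjMatrix ℝ ^ n) u v := by
  rw [adjMatrix_pow_apply_eq_card_walk]
  positivity

theorem adjMatrix_pow_apply_eq_zero {n : ℕ} {u v : V} (h : n < G.dist u v) :
    (G.adjMatrix ℝ ^ n) u v = 0 := by
  rw [adjMatrix_pow_apply_eq_card_walk, Nat.cast_eq_zero, Fintype.card_eq_zero_iff]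
  refine ⟨fun ⟨p, hp⟩ => (dist_le p).not_gt ?_⟩
  rwa [show p.length = n from hp]

theorem Connected.adjMatrix_pow_dist_apply_pos (hG : G.Connected) (u v : V) :
    0 < (G.adjMatrix ℝ ^ G.dist u v) u v := by
  rw [adjMatrix_pow_apply_eq_card_walk, Nat.cast_pos, Fintype.card_pos_iff]
  obtain ⟨p, hp⟩ := hG.exists_walk_length_eq_dist u v
  exact ⟨⟨p, hp⟩⟩

theorem aeval_adjMatrix_apply_eq_sum {q : ℝ[X]} {n : ℕ} (hq : q.natDegree ≤ n) (u v : V) :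
    aeval (G.adjMatrix ℝ) q u v =
      ∑ k ∈ Finset.range (n + 1), q.coeff k * (G.adjMatrix ℝ ^ k) u v := by
  rw [aeval_eq_sum_range' (Nat.lt_succ_of_le hq), Matrix.sum_apply]
  rfl

theorem aeval_adjMatrix_apply_eq_zero {q : ℝ[X]} {u v : V} (h : q.natDegree < G.dist u v) :
    aeval (G.adjMatrix ℝ) q u v = 0 := by
  rw [aeval_adjMatrix_apply_eq_sum le_rfl]
  refine Finset.sum_eq_zero fun k hk => ?_
  rw [adjMatrix_pow_apply_eq_zero (by have := Finset.mem_range.mp hk; omega), mul_zero]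

theorem aeval_adjMatrix_apply_of_dist {q : ℝ[X]} {u v : V} (h : q.natDegree ≤ G.dist u v) :
    aeval (G.adjMatrix ℝ) q u v =
      q.coeff (G.dist u v) * (G.adjMatrix ℝ ^ G.dist u v) u v := by
  rw [aeval_adjMatrix_apply_eq_sum h, Finset.sum_range_succ, Finset.sum_eq_zero, zero_add]
  intro k hk
  rw [adjMatrix_pow_apply_eq_zero (Finset.mem_range.mp hk), mul_zero]

theorem Connected.aeval_adjMatrix_apply_ne_zero (hG : G.Connected) {q : ℝ[X]} (hq : q ≠ 0)
    {u v : V} (h : q.natDegree = G.dist u v) : aeval (G.adjMatrix ℝ) q u v ≠ 0 := by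
  rw [aeval_adjMatrix_apply_of_dist h.le, ← h]
  exact mul_ne_zero (leadingCoeff_ne_zero.mpr hq) (h ▸ (hG.adjMatrix_pow_dist_apply_pos u v).ne')

theorem aeval_adjMatrix_apply_comm (q : ℝ[X]) (u v : V) :
    aeval (G.adjMatrix ℝ) q u v = aeval (G.adjMatrix ℝ) q v u := by
  have h (k : ℕ) : (G.adjMatrix ℝ ^ k) u v = (G.adjMatrix ℝ ^ k) v u := by
    conv_lhs => rw [← transpose_adjMatrix, ← Matrix.transpose_pow, Matrix.transpose_apply]
  simp_rw [aeval_adjMatrix_apply_eq_sum le_rfl, h]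

/-- If the columns of `p(A)` indexed by `x` vanish at distance less than `D`, then those of
`(g * p)(A)` vanish at distance less than `D - deg g`. -/
theorem Connected.aeval_adjMatrix_mul_apply_eq_zero (hG : G.Connected) {g p : ℝ[X]} {D : ℕ}
    {x v : V} (hp : ∀ w, G.dist w x < D → aeval (G.adjMatrix ℝ) p w x = 0)
    (h : G.dist v x + g.natDegree < D) : aeval (G.adjMatrix ℝ) (g * p) v x = 0 := by
  rw [map_mul, Matrix.mul_apply]
  refine Finset.sum_eq_zero fun w _ => ?_
  by_cases hw : G.dist w x < D
  · rw [hp w hw, mul_zero]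
  · have := hG.dist_triangle (u := w) (v := v) (w := x)
    rw [G.dist_comm (u := w) (v := v)] at this
    rw [aeval_adjMatrix_apply_eq_zero, zero_mul]
    omega

theorem aeval_mul_apply_eq_zero {f : ℝ[X]} {x : V}
    (hf : ∀ v, aeval (G.adjMatrix ℝ) f v x = 0) (g : ℝ[X]) (v : V) :
    aeval (G.adjMatrix ℝ) (g * f) v x = 0 := by
  rw [map_mul, Matrix.mul_apply]
  exact Finset.sum_eq_zero fun w _ => by rw [hf, mul_zero]

theorem aeval_mulVec_of_eigenvector {ν : V → ℝ} {μ : ℝ} (h : G.adjMatrix ℝ *ᵥ ν = μ • ν)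
    (q : ℝ[X]) : aeval (G.adjMatrix ℝ) q *ᵥ ν = q.eval μ • ν := by
  induction q using Polynomial.induction_on' with
  | add p q hp hq => simp [add_mulVec, hp, hq, add_smul]
  | monomial n a =>
    induction n with
    | zero => simp [Algebra.algebraMap_eq_smul_one, smul_mulVec]
    | succ n ih =>
      rw [← monomial_mul_X, map_mul, aeval_X, ← mulVec_mulVec, h, mulVec_smul, ih, smul_smul,
        eval_mul_X, mul_comm]

/-- The Perron eigenvector of a connected graph. -/
theorem Connected.exists_pos_eigenvector (hG : G.Connected) :
    ∃ (μ : ℝ) (ν : V → ℝ), (∀ v, 0 < ν v) ∧ G.adjMatrix ℝ *ᵥ ν = μ • ν ∧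
      ∀ w, G.adjMatrix ℝ *ᵥ w = μ • w → ∃ c : ℝ, w = c • ν := by
  have : Nonempty V := hG.nonempty
  have hA := G.isHermitian_adjMatrix ℝ
  obtain ⟨i₀, hi₀⟩ := Finite.exists_max hA.eigenvalues
  set μ := hA.eigenvalues i₀ with hμ
  have hpsd : (algebraMap ℝ (Matrix V V ℝ) μ - G.adjMatrix ℝ).PosSemidef := by
    rw [posSemidef_iff_isHermitian_and_spectrum_nonneg]
    refine ⟨?_, ?_⟩
    · rw [Matrix.algebraMap_eq_diagonal]
      exact (Matrix.isHermitian_diagonal _).sub hA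
    · rw [← spectrum.singleton_sub_eq, hA.spectrum_real_eq_range_eigenvalues]
      rintro _ ⟨_, rfl, _, ⟨i, rfl⟩, rfl⟩
      simpa using hi₀ i
  have hsub (w : V → ℝ) : (algebraMap ℝ (Matrix V V ℝ) μ - G.adjMatrix ℝ) *ᵥ w =
      μ • w - G.adjMatrix ℝ *ᵥ w := by
    rw [sub_mulVec, Algebra.algebraMap_eq_smul_one, smul_mulVec, one_mulVec]
  have habs {w : V → ℝ} (hw : G.adjMatrix ℝ *ᵥ w = μ • w) :
      G.adjMatrix ℝ *ᵥ |w| = μ • |w| := by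
    have h₁ := hpsd.dotProduct_mulVec_nonneg |w|
    have h₂ : (|w| : V → ℝ) ⬝ᵥ (G.adjMatrix ℝ *ᵥ |w|) ≥ w ⬝ᵥ (G.adjMatrix ℝ *ᵥ w) := by
      simp only [dotProduct, mulVec, Finset.mul_sum]
      refine Finset.sum_le_sum fun i _ => Finset.sum_le_sum fun j _ => ?_
      have : 0 ≤ G.adjMatrix ℝ i j := by rw [adjMatrix_apply]; split_ifs <;> norm_num
      calc w i * (G.adjMatrix ℝ i j * w j) = G.adjMatrix ℝ i j * (w i * w j) := by ring
        _ ≤ G.adjMatrix ℝ i j * |w i * w j| := by gcongr; exact le_abs_self _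
        _ = _ := by rw [abs_mul, Pi.abs_apply, Pi.abs_apply]; ring
    have h₃ : (|w| : V → ℝ) ⬝ᵥ |w| = w ⬝ᵥ w := by simp [dotProduct]
    have h₄ := (hpsd.dotProduct_mulVec_zero_iff |w|).mp (by
      refine le_antisymm ?_ h₁
      rw [hw, dotProduct_smul] at h₂
      rw [hsub, star_trivial, dotProduct_sub, dotProduct_smul, h₃]
      linarith)
    rw [hsub, sub_eq_zero] at h₄
    exact h₄.symm
  have hne {w : V → ℝ} (hw : G.adjMatrix ℝ *ᵥ w = μ • w) {v : V} (hv : w v = 0) : w = 0 := by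
    have hstep {a b : V} (hab : G.Adj a b) (ha : w a = 0) : w b = 0 := by
      have h := congrFun (habs hw) a
      rw [adjMatrix_mulVec_apply] at h
      simp only [Pi.smul_apply, Pi.abs_apply, ha, abs_zero, smul_zero] at h
      have := (Finset.sum_eq_zero_iff_of_nonneg fun i _ => abs_nonneg (w i)).mp h b
        ((G.mem_neighborFinset a b).mpr hab)
      exact abs_eq_zero.mp this
    have hwalk {a b : V} (p : G.Walk a b) : w a = 0 → w b = 0 := by
      induction p with
      | nil => exact id
      | cons h _ ih => exact fun ha => ih (hstep h ha)
    funext b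
    exact hwalk (hG.preconnected v b).some hv
  obtain ⟨w, hw₀, hw⟩ : ∃ w : V → ℝ, w ≠ 0 ∧ G.adjMatrix ℝ *ᵥ w = μ • w :=
    ⟨_, fun h => hA.eigenvectorBasis.orthonormal.ne_zero i₀ (by ext v; exact congrFun h v),
      hA.mulVec_eigenvectorBasis i₀⟩
  have hpos (v : V) : 0 < |w| v := abs_pos.mpr fun h => hw₀ (hne hw h)
  refine ⟨μ, |w|, hpos, habs hw, fun u hu => ?_⟩
  obtain ⟨v⟩ := this
  refine ⟨u v / |w| v, sub_eq_zero.mp (hne (v := v) ?_ ?_)⟩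
  · rw [mulVec_sub, mulVec_smul, hu, habs hw, smul_sub, smul_comm]
  · simp only [Pi.sub_apply, Pi.smul_apply, smul_eq_mul]
    rw [div_mul_cancel₀ _ (hpos v).ne', sub_self]

theorem _root_.Polynomial.exists_dvd_sub_mul_of_natDegree_le {K : Type*} [Field K] {f : K[X]}
    {D : ℕ} (hf : f.natDegree = D + 1) (p : K[X]) {i : ℕ} (hi : i ≤ D) :
    ∃ r g : K[X], r.natDegree ≤ i ∧ g.natDegree ≤ D - i ∧ (r = 0 → g ≠ 0) ∧ f ∣ r - g * p := by
  classical
  have hf₀ : f ≠ 0 := by rintro rfl; simp at hf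
  have hm := monic_normalize hf₀
  have hdeg : (normalize f).degree = ((D + 1 : ℕ) : WithBot ℕ) := by
    rw [degree_normalize, degree_eq_natDegree hf₀, hf]
  let φ : degreeLT K (i + 1) × degreeLT K (D - i + 1) →ₗ[K] degreeLT K (D + 1) :=
    LinearMap.codRestrict _
      (modByMonicHom (normalize f) ∘ₗ ((degreeLT K (i + 1)).subtype ∘ₗ LinearMap.fst K _ _ -
        LinearMap.mulRight K p ∘ₗ (degreeLT K (D - i + 1)).subtype ∘ₗ LinearMap.snd K _ _))
      fun z => mem_degreeLT.mpr (hdeg ▸ degree_modByMonic_lt _ hm)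
  have hfr (n : ℕ) : Module.finrank K (degreeLT K n) = n := by
    rw [(degreeLTEquiv K n).finrank_eq, Module.finrank_fin_fun]
  have hfd (n : ℕ) : FiniteDimensional K (degreeLT K n) :=
    (degreeLTEquiv K n).symm.finiteDimensional
  have hker : LinearMap.ker φ ≠ ⊥ := LinearMap.ker_ne_bot_of_finrank_lt (by
    rw [Module.finrank_prod, hfr, hfr, hfr]; omega)
  obtain ⟨⟨⟨r, hr⟩, ⟨g, hg⟩⟩, hz, hne⟩ := (Submodule.ne_bot_iff _).mp hker
  have hdl {q : K[X]} {n : ℕ} (hq : q ∈ degreeLT K (n + 1)) : q.natDegree ≤ n :=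
    natDegree_le_of_degree_le (Order.lt_succ_iff.mp (mem_degreeLT.mp hq))
  refine ⟨r, g, hdl hr, hdl hg, ?_, ?_⟩
  · rintro rfl rfl
    exact hne rfl
  · have h : (r - g * p) %ₘ normalize f = 0 := congrArg Subtype.val (LinearMap.mem_ker.mp hz)
    exact normalize_dvd_iff.mp ((modByMonic_eq_zero_iff_dvd hm).mp h)

theorem Connected.aeval_mul_apply_self_ne_zero (hG : G.Connected) {g p : ℝ[X]} {D : ℕ}
    (hg₀ : g ≠ 0) (hg : g.natDegree = D) (hp₀ : p ≠ 0) (hp : p.natDegree = D) {x y : V}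
    (hpx : ∀ w, G.dist w x < D → aeval (G.adjMatrix ℝ) p w x = 0) (hxy : G.dist y x = D) :
    aeval (G.adjMatrix ℝ) (g * p) x x ≠ 0 := by
  have key (w : V) : aeval (G.adjMatrix ℝ) g x w * aeval (G.adjMatrix ℝ) p w x =
      g.leadingCoeff * p.leadingCoeff *
        if G.dist w x = D then ((G.adjMatrix ℝ ^ D) w x) ^ 2 else 0 := by
    rcases lt_trichotomy (G.dist w x) D with h | h | h
    · rw [hpx w h, if_neg h.ne, mul_zero, mul_zero]
    · rw [if_pos h, aeval_adjMatrix_apply_comm, aeval_adjMatrix_apply_of_dist (by omega),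
        aeval_adjMatrix_apply_of_dist (by omega), h, leadingCoeff, leadingCoeff, hg, hp]
      ring
    · rw [aeval_adjMatrix_apply_eq_zero (q := p) (by omega), if_neg h.ne', mul_zero, mul_zero]
  rw [map_mul, Matrix.mul_apply, Finset.sum_congr rfl fun w _ => key w, ← Finset.mul_sum]
  refine mul_ne_zero (mul_ne_zero (leadingCoeff_ne_zero.mpr hg₀) (leadingCoeff_ne_zero.mpr hp₀))
    (Finset.sum_pos' (fun w _ => by positivity) ⟨y, Finset.mem_univ y, ?_⟩).ne'
  rw [if_pos hxy, ← hxy]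
  exact pow_pos (hG.adjMatrix_pow_dist_apply_pos y x) 2

theorem Connected.exists_monic_aeval_apply_eq_zero (hG : G.Connected) {S : Finset V}
    {f p : ℝ[X]} {D : ℕ} (hf : f.natDegree = D + 1)
    (hfX : ∀ x ∈ S, ∀ v, aeval (G.adjMatrix ℝ) f v x = 0)
    (hp₀ : p ≠ 0) (hp : p.natDegree = D)
    (hpX : ∀ x ∈ S, ∀ v, G.dist v x < D → aeval (G.adjMatrix ℝ) p v x = 0)
    {x₀ y₀ : V} (hx₀ : x₀ ∈ S) (hxy : G.dist y₀ x₀ = D) {i : ℕ} (hi : i ≤ D) :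
    ∃ r : ℝ[X], r.Monic ∧ r.natDegree = i ∧
      ∀ x ∈ S, ∀ v, G.dist v x ≠ i → aeval (G.adjMatrix ℝ) r v x = 0 := by
  obtain ⟨r, g, hr, hg, hrg, h, hfh⟩ := exists_dvd_sub_mul_of_natDegree_le hf p hi
  have heq {x : V} (hx : x ∈ S) (v : V) :
      aeval (G.adjMatrix ℝ) r v x = aeval (G.adjMatrix ℝ) (g * p) v x := by
    rw [eq_add_of_sub_eq hfh, map_add, Matrix.add_apply, mul_comm f,
      aeval_mul_apply_eq_zero (hfX x hx), zero_add]
  have hlow {x : V} (hx : x ∈ S) {v : V} (hv : G.dist v x < i) :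
      aeval (G.adjMatrix ℝ) r v x = 0 := by
    rw [heq hx, hG.aeval_adjMatrix_mul_apply_eq_zero (hpX x hx) (by omega)]
  have hr₀ : r ≠ 0 := by
    intro hr₀
    have hg₀ := hrg hr₀
    have hXg : X ^ (D - g.natDegree) * g ≠ 0 := mul_ne_zero (pow_ne_zero _ X_ne_zero) hg₀
    refine hG.aeval_mul_apply_self_ne_zero hXg ?_ hp₀ hp (hpX x₀ hx₀) hxy ?_
    · rw [natDegree_mul (pow_ne_zero _ X_ne_zero) hg₀, natDegree_X_pow]
      omega
    · rw [mul_assoc]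
      exact aeval_mul_apply_eq_zero (fun v => by rw [← heq hx₀, hr₀]; simp) _ _
  have hri : r.natDegree = i := by
    refine hr.antisymm (not_lt.mp fun hlt => ?_)
    obtain ⟨v, hv, -⟩ := hG.exists_dist_eq (x := x₀) (y := y₀) (j := r.natDegree) (by omega)
    exact hG.aeval_adjMatrix_apply_ne_zero hr₀ hv.symm (hlow hx₀ (by omega))
  refine ⟨normalize r, monic_normalize hr₀, ?_, fun x hx v hv => ?_⟩
  · rw [← hri]
    exact natDegree_eq_of_degree_eq degree_normalize
  · rw [normalize_apply, mul_comm]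
    rw [map_mul, Polynomial.coe_normUnit, aeval_C, Matrix.algebraMap_eq_diagonal,
      Matrix.diagonal_mul]
    rcases hv.lt_or_gt with h | h
    · rw [hlow hx h, mul_zero]
    · rw [aeval_adjMatrix_apply_eq_zero (by omega), mul_zero]

/-- Every polynomial of degree at most `D` has columns that are, distance by distance, multiples
of the columns of the powers of `A`. -/
theorem exists_aeval_apply_eq_mul_pow_dist {S : Finset V} {D : ℕ}
    (hr : ∀ i ≤ D, ∃ r : ℝ[X], r.Monic ∧ r.natDegree = i ∧
      ∀ x ∈ S, ∀ v, G.dist v x ≠ i → aeval (G.adjMatrix ℝ) r v x = 0)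
    {n : ℕ} (hn : n ≤ D) {q : ℝ[X]} (hq : q.natDegree ≤ n) :
    ∃ t : ℕ → ℝ, ∀ x ∈ S, ∀ v,
      aeval (G.adjMatrix ℝ) q v x = t (G.dist v x) * (G.adjMatrix ℝ ^ G.dist v x) v x := by
  induction n generalizing q with
  | zero =>
    refine ⟨fun k => q.coeff k, fun x hx v => ?_⟩
    rw [aeval_adjMatrix_apply_of_dist (by omega)]
  | succ n ih =>
    obtain ⟨r, hrm, hrn, hrX⟩ := hr (n + 1) hn
    have hdeg : (q - C (q.coeff (n + 1)) * r).natDegree ≤ n := by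
      rw [natDegree_le_iff_coeff_eq_zero]
      intro k hk
      rcases (Nat.succ_le_of_lt hk).eq_or_lt with rfl | hk
      · have : r.coeff n.succ = 1 := by rw [← hrm.coeff_natDegree, hrn]
        simp [this]
      · rw [coeff_sub, coeff_C_mul, coeff_eq_zero_of_natDegree_lt (p := q) (by omega),
          coeff_eq_zero_of_natDegree_lt (p := r) (by omega), mul_zero, sub_zero]
    obtain ⟨t, ht⟩ := ih (by omega) hdeg
    refine ⟨fun k => t k + if k = n + 1 then q.coeff (n + 1) else 0, fun x hx v => ?_⟩
    have h := ht x hx v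
    rw [map_sub, map_mul, aeval_C, Matrix.sub_apply, Matrix.algebraMap_eq_diagonal,
      Matrix.diagonal_mul, sub_eq_iff_eq_add] at h
    rw [h, add_mul]
    congr 1
    split_ifs with hd
    · rw [aeval_adjMatrix_apply_of_dist (by omega), hd, ← hrn, hrm.coeff_natDegree, one_mul]
      rfl
    · rw [hrX x hx v hd, mul_zero, zero_mul]

theorem neg_adjMatrix_pow_apply {S : Finset V} (hS : ∀ u v, G.Adj u v → (u ∈ S ↔ v ∉ S)) (n : ℕ)
    (u v : V) : ((-G.adjMatrix ℝ) ^ n) u v =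
      if (u ∈ S ↔ v ∈ S) then (G.adjMatrix ℝ ^ n) u v else -(G.adjMatrix ℝ ^ n) u v := by
  induction n generalizing v with
  | zero => by_cases h : u = v <;> simp [h]
  | succ n ih =>
    have key (w : V) : ((-G.adjMatrix ℝ) ^ n) u w * (-G.adjMatrix ℝ) w v =
        if (u ∈ S ↔ v ∈ S) then (G.adjMatrix ℝ ^ n) u w * G.adjMatrix ℝ w v
        else -((G.adjMatrix ℝ ^ n) u w * G.adjMatrix ℝ w v) := by
      rw [ih, Matrix.neg_apply, adjMatrix_apply]
      by_cases hwv : G.Adj w v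
      · have := hS w v hwv
        by_cases hu : u ∈ S <;> by_cases hv : v ∈ S <;> simp_all
      · simp [hwv]
    rw [pow_succ, pow_succ, Matrix.mul_apply, Matrix.mul_apply,
      Finset.sum_congr rfl fun w _ => key w]
    split_ifs
    · rfl
    · rw [Finset.sum_neg_distrib]

theorem aeval_comp_neg_X_apply {S : Finset V} (hS : ∀ u v, G.Adj u v → (u ∈ S ↔ v ∉ S))
    (q : ℝ[X]) (u v : V) : aeval (G.adjMatrix ℝ) (q.comp (-X)) u v =
      if (u ∈ S ↔ v ∈ S) then aeval (G.adjMatrix ℝ) q u v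
      else -aeval (G.adjMatrix ℝ) q u v := by
  have h : aeval (G.adjMatrix ℝ) (q.comp (-X)) u v =
      ∑ k ∈ Finset.range (q.natDegree + 1), q.coeff k * ((-G.adjMatrix ℝ) ^ k) u v := by
    rw [aeval_comp, map_neg, aeval_X, aeval_eq_sum_range, Matrix.sum_apply]
    rfl
  rw [h, aeval_adjMatrix_apply_eq_sum le_rfl, ← Finset.sum_neg_distrib]
  simp_rw [neg_adjMatrix_pow_apply hS]
  split_ifs <;> simp

theorem Connected.even_dist_iff (hG : G.Connected) {S : Finset V}
    (hS : ∀ u v, G.Adj u v → (u ∈ S ↔ v ∉ S)) (u v : V) :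
    Even (G.dist u v) ↔ (u ∈ S ↔ v ∈ S) := by
  have hpos := hG.adjMatrix_pow_dist_apply_pos u v
  have h := neg_adjMatrix_pow_apply hS (G.dist u v) u v
  rcases Nat.even_or_odd (G.dist u v) with he | ho
  · rw [he.neg_pow] at h
    refine iff_of_true he (by_contra fun hn => ?_)
    rw [if_neg hn] at h
    linarith
  · rw [ho.neg_pow, Matrix.neg_apply] at h
    refine iff_of_false (Nat.not_even_iff_odd.mpr ho) fun hn => ?_
    rw [if_pos hn] at h
    linarith

/-- Let `λ` be the Perron eigenvalue. If `f(A)` vanishes on the columns in `S`, the cofactor of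
`X - λ` in `f` has columns in `S` proportional to the Perron eigenvector. -/
theorem Connected.exists_aeval_apply_eq_perron (hG : G.Connected) {S : Finset V} {f : ℝ[X]} {D : ℕ}
    (hf : f.natDegree = D + 1) (hfS : ∀ x ∈ S, ∀ v, aeval (G.adjMatrix ℝ) f v x = 0)
    {x₀ y₀ : V} (hx₀ : x₀ ∈ S) (hxy : G.dist y₀ x₀ = D) :
    ∃ (h : ℝ[X]) (c : ℝ) (ν : V → ℝ), h.natDegree ≤ D ∧ c ≠ 0 ∧ (∀ v, 0 < ν v) ∧
      ∀ x ∈ S, ∀ v, aeval (G.adjMatrix ℝ) h v x = c * ν v * ν x := by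
  obtain ⟨μ, ν, hν, hAν, huniq⟩ := hG.exists_pos_eigenvector
  have hleft (q : ℝ[X]) (x : V) :
      ∑ v, aeval (G.adjMatrix ℝ) q v x * ν v = q.eval μ * ν x := by
    have := congrFun (aeval_mulVec_of_eigenvector hAν q) x
    simp_rw [aeval_adjMatrix_apply_comm q _ x]
    exact this
  have hf₀ : f ≠ 0 := by rintro rfl; simp at hf
  obtain ⟨h, rfl⟩ : X - C μ ∣ f := by
    refine dvd_iff_isRoot.mpr (?_ : f.eval μ = 0)
    have := hleft f x₀
    simp only [hfS x₀ hx₀, zero_mul, Finset.sum_const_zero] at this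
    exact (mul_eq_zero.mp this.symm).resolve_right (hν x₀).ne'
  have hh₀ : h ≠ 0 := right_ne_zero_of_mul hf₀
  have hh : h.natDegree = D := by
    rw [natDegree_mul (X_sub_C_ne_zero μ) hh₀, natDegree_X_sub_C] at hf
    omega
  have hN : 0 < ∑ v, ν v * ν v :=
    Finset.sum_pos (fun v _ => mul_pos (hν v) (hν v)) ⟨x₀, Finset.mem_univ _⟩
  have hcol : ∀ x ∈ S, ∀ v,
      aeval (G.adjMatrix ℝ) h v x = h.eval μ / (∑ v, ν v * ν v) * ν v * ν x := by
    intro x hx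
    obtain ⟨b, hb⟩ := huniq (fun v => aeval (G.adjMatrix ℝ) h v x) (by
      funext v
      have := hfS x hx v
      rw [map_mul, map_sub, aeval_X, aeval_C, sub_mul, Matrix.sub_apply,
        Matrix.algebraMap_eq_diagonal, Matrix.diagonal_mul, sub_eq_zero] at this
      exact this)
    have hb' (v : V) : aeval (G.adjMatrix ℝ) h v x = b * ν v := congrFun hb v
    have hsum := hleft h x
    simp_rw [hb', mul_assoc, ← Finset.mul_sum] at hsum
    intro v
    rw [hb', eq_div_of_mul_eq hN.ne' hsum]
    ring
  refine ⟨h, _, ν, hh.le, fun hc => ?_, hν, hcol⟩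
  refine hG.aeval_adjMatrix_apply_ne_zero hh₀ (hh.trans hxy.symm) ?_
  rw [hcol x₀ hx₀, hc, zero_mul, zero_mul]

theorem Connected.pow_dist_apply_eq (hG : G.Connected) {S : Finset V}
    (hS : ∀ u v, G.Adj u v → (u ∈ S ↔ v ∉ S)) {ν : V → ℝ} (hν : ∀ v, 0 < ν v) {c : ℝ}
    (hc : c ≠ 0) {t : ℕ → ℝ}
    (ht : ∀ x ∈ S, ∀ v, t (G.dist v x) * (G.adjMatrix ℝ ^ G.dist v x) v x = c * ν v * ν x)
    {x v x' v' : V} (hx : x ∈ S) (hx' : x' ∈ S) (hd : G.dist v x = G.dist v' x') :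
    (G.adjMatrix ℝ ^ G.dist v x) v x = (G.adjMatrix ℝ ^ G.dist v' x') v' x' := by
  have hin {a b : V} (ha : a ∈ S) (hb : b ∈ S) : ν a = ν b := by
    have h₁ := ht a ha a
    have h₂ := ht b hb b
    rw [dist_self, pow_zero, Matrix.one_apply_eq] at h₁ h₂
    have h₃ : ν a ^ 2 = ν b ^ 2 := mul_left_cancel₀ hc (by linarith)
    exact (pow_left_inj₀ (hν a).le (hν b).le two_ne_zero).mp h₃
  have hnbr {a : V} (ha : a ∉ S) : ∃ w ∈ S, G.dist a w = 1 := by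
    have hax : a ≠ x := fun h => ha (h ▸ hx)
    obtain ⟨w, hw, -⟩ := hG.exists_dist_eq (x := a) (y := x) (j := 1)
      (hG.pos_dist_of_ne hax.symm)
    exact ⟨w, (hS w a (dist_eq_one_iff_adj.mp hw)).mpr ha, by rw [dist_comm, hw]⟩
  have hout {a b : V} (ha : a ∉ S) (hb : b ∉ S) : ν a = ν b := by
    obtain ⟨w, hw, haw⟩ := hnbr ha
    obtain ⟨z, hz, hbz⟩ := hnbr hb
    have h₁ := ht w hw a
    have h₂ := ht z hz b
    rw [haw, pow_one, adjMatrix_apply, if_pos (dist_eq_one_iff_adj.mp haw)] at h₁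
    rw [hbz, pow_one, adjMatrix_apply, if_pos (dist_eq_one_iff_adj.mp hbz), hin hz hw] at h₂
    have h₃ : c * ν a * ν w = c * ν b * ν w := by rw [← h₁, ← h₂]
    exact mul_left_cancel₀ hc (mul_right_cancel₀ (hν w).ne' h₃)
  have hvv : ν v = ν v' := by
    have h₁ := hG.even_dist_iff hS v x
    have h₂ := hG.even_dist_iff hS v' x'
    rw [hd] at h₁
    by_cases hv : v ∈ S
    · exact hin hv (by tauto)
    · exact hout hv (by tauto)
  have h₁ := ht x hx v
  have h₂ := ht x' hx' v'
  have ht₀ : t (G.dist v x) ≠ 0 := by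
    intro h
    rw [h, zero_mul] at h₁
    exact mul_ne_zero (mul_ne_zero hc (hν v).ne') (hν x).ne' h₁.symm
  refine mul_left_cancel₀ ht₀ ?_
  rw [h₁, hvv, hin hx hx', ← h₂, hd]

/-- In a connected bipartite graph with side `S`, a polynomial of degree `D` whose columns in `S`
vanish at distance less than `D`, together with an annihilator of degree `D + 1` of the columns
in `S`, yields all distance polynomials of `S` up to degree `D`. -/
theorem Connected.exists_distance_polynomial (hG : G.Connected) {S : Finset V}
    (hS : ∀ u v, G.Adj u v → (u ∈ S ↔ v ∉ S)) {f p : ℝ[X]} {D : ℕ} (hf : f.natDegree = D + 1)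
    (hfS : ∀ x ∈ S, ∀ v, aeval (G.adjMatrix ℝ) f v x = 0) (hp : p.degree = (D : WithBot ℕ))
    (hpS : ∀ x ∈ S, ∀ v, G.dist v x < D → aeval (G.adjMatrix ℝ) p v x = 0)
    {x₀ y₀ : V} (hx₀ : x₀ ∈ S) (hxy : G.dist y₀ x₀ = D) {i : ℕ} (hi : i ≤ D) :
    ∃ q : ℝ[X], q.degree = (i : WithBot ℕ) ∧
      ∀ x ∈ S, ∀ v, aeval (G.adjMatrix ℝ) q v x = if G.dist v x = i then 1 else 0 := by
  have hp₀ : p ≠ 0 := by rintro rfl; simp at hp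
  have hr := fun j (hj : j ≤ D) => hG.exists_monic_aeval_apply_eq_zero hf hfS hp₀
    (natDegree_eq_of_degree_eq_some hp) hpS hx₀ hxy hj
  obtain ⟨h, c, ν, hh, hc, hν, hhS⟩ := hG.exists_aeval_apply_eq_perron hf hfS hx₀ hxy
  obtain ⟨t, ht⟩ := exists_aeval_apply_eq_mul_pow_dist hr le_rfl hh
  have ht' : ∀ x ∈ S, ∀ v,
      t (G.dist v x) * (G.adjMatrix ℝ ^ G.dist v x) v x = c * ν v * ν x :=
    fun x hx v => (ht x hx v).symm.trans (hhS x hx v)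
  obtain ⟨r, hrm, hri, hrS⟩ := hr i hi
  obtain ⟨y, hy, -⟩ := hG.exists_dist_eq (x := x₀) (y := y₀) (j := i) (by omega)
  have hρ := (hG.adjMatrix_pow_dist_apply_pos y x₀).ne'
  refine ⟨C ((G.adjMatrix ℝ ^ G.dist y x₀) y x₀)⁻¹ * r, ?_, fun x hx v => ?_⟩
  · rw [degree_C_mul (inv_ne_zero hρ), degree_eq_natDegree hrm.ne_zero, hri]
  · rw [map_mul, aeval_C, Matrix.algebraMap_eq_diagonal, Matrix.diagonal_mul]
    split_ifs with hd
    · rw [aeval_adjMatrix_apply_of_dist (by omega), hd, ← hri, hrm.coeff_natDegree, hri, ← hd,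
        one_mul, hG.pow_dist_apply_eq hS hν hc ht' hx hx₀ (hd.trans hy.symm)]
      exact inv_mul_cancel₀ hρ
    · rw [hrS x hx v hd, mul_zero]

/-- The transfer to the opposite side, when no vertex outside `S` has eccentricity `d`. -/
theorem Connected.exists_distance_polynomial_compl (hG : G.Connected) {S T : Finset V}
    (hS : ∀ u v, G.Adj u v → (u ∈ S ↔ v ∉ S)) (hT : ∀ v, v ∈ T ↔ v ∉ S) {d : ℕ}
    (hd : ∀ u v, G.dist u v ≤ d) {x₀ y₀ : V} (hx₀ : x₀ ∈ S) (hxy : G.dist y₀ x₀ = d)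
    (hTd : ∀ y ∈ T, ∀ v, G.dist v y ≠ d) {f : ℝ[X]} (hf : f.degree = (d : WithBot ℕ))
    (hfT : ∀ y ∈ T, ∀ v, aeval (G.adjMatrix ℝ) f v y = 0)
    (hq : ∀ i ≤ d, ∃ q : ℝ[X], q.degree = (i : WithBot ℕ) ∧
      ∀ x ∈ S, ∀ v, aeval (G.adjMatrix ℝ) q v x = if G.dist v x = i then 1 else 0)
    {i : ℕ} (hi : i ≤ d) :
    ∃ q : ℝ[X], q.degree = (i : WithBot ℕ) ∧
      ∀ y ∈ T, ∀ v, aeval (G.adjMatrix ℝ) q v y = if G.dist v y = i then 1 else 0 := by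
  rcases hi.eq_or_lt with rfl | hlt
  · exact ⟨f, hf, fun y hy v => by rw [hfT y hy, if_neg (hTd y hy v)]⟩
  obtain ⟨D, rfl⟩ : ∃ D, d = D + 1 := ⟨d - 1, by omega⟩
  have hTS : ∀ u v, G.Adj u v → (u ∈ T ↔ v ∉ T) := fun u v huv => by
    have := hS u v huv
    simp only [hT]
    tauto
  have hy₀ : y₀ ∈ S := by
    by_contra h
    exact hTd y₀ ((hT y₀).mpr h) x₀ (by rw [dist_comm, hxy])
  have hodd : ¬Even D := Nat.even_add_one.mp
    (hxy ▸ (hG.even_dist_iff hS y₀ x₀).mpr (iff_of_true hy₀ hx₀))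
  obtain ⟨c, hc, hyc⟩ := hG.exists_dist_eq (x := x₀) (y := y₀) (j := 1) (by omega)
  have hcT : c ∈ T := by
    have := hS c x₀ (dist_eq_one_iff_adj.mp hc)
    rw [hT]
    tauto
  obtain ⟨q, hqD, hqS⟩ := hq D (by omega)
  have hqn := natDegree_eq_of_degree_eq_some hqD
  have hcoeff : (q.comp (-X)).coeff D = -q.coeff D := by
    have h := comp_neg_X_leadingCoeff_eq q
    rwa [leadingCoeff, natDegree_eq_of_degree_eq degree_comp_neg_X, leadingCoeff, hqn,
      (Nat.not_even_iff_odd.mp hodd).neg_one_pow, neg_one_mul] at h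
  refine hG.exists_distance_polynomial (f := f) (p := q - q.comp (-X)) (D := D) hTS
    (natDegree_eq_of_degree_eq_some hf) hfT ?_ (fun y hy v hv => ?_) hcT (y₀ := y₀) (by omega)
    (by omega)
  · refine degree_eq_of_le_of_coeff_ne_zero
      ((degree_sub_le _ _).trans (by rw [degree_comp_neg_X, max_self, hqD])) ?_
    rw [coeff_sub, hcoeff, sub_neg_eq_add, ← two_mul]
    refine mul_ne_zero two_ne_zero (coeff_ne_zero_of_eq_degree hqD)
  · rw [map_sub, Matrix.sub_apply, aeval_comp_neg_X_apply hTS]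
    split_ifs with h
    · exact sub_self _
    · have hvS : v ∈ S := by
        rw [hT v] at h
        tauto
      rw [aeval_adjMatrix_apply_comm, hqS v hvS, dist_comm, if_neg hv.ne, neg_zero, sub_zero]

theorem exists_natDegree_eq_ncard_spectrum_and_aeval_eq_zero :
    ∃ f : ℝ[X], f.natDegree = (spectrum ℝ (G.adjMatrix ℝ)).ncard ∧
      aeval (G.adjMatrix ℝ) f = 0 := by
  have hfin := (G.adjMatrix ℝ).finite_real_spectrum
  refine ⟨∏ μ ∈ hfin.toFinset, (X - C μ), ?_, ?_⟩
  · rw [natDegree_finsetProd_X_sub_C_eq_card, Set.ncard_eq_toFinset_card _ hfin]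
  · rw [← cfc_polynomial _ _ (G.isHermitian_adjMatrix ℝ).isSelfAdjoint,
      ← cfc_zero ℝ (G.adjMatrix ℝ)]
    refine cfc_congr fun μ hμ => ?_
    rw [eval_prod]
    exact Finset.prod_eq_zero (hfin.mem_toFinset.mpr hμ) (by simp)

theorem mulVec_single_eq_distMatrix_iff {q : ℝ[X]} {S : Finset V} {i : ℕ} :
    (∀ x ∈ S, aeval (G.adjMatrix ℝ) q *ᵥ Pi.single x 1 = distMatrix G i *ᵥ Pi.single x 1) ↔
      ∀ x ∈ S, ∀ v, aeval (G.adjMatrix ℝ) q v x = if G.dist v x = i then 1 else 0 := by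
  simp only [mulVec_single_one, funext_iff]
  rfl

/-- The distance polynomials of both sides, when some vertex of `S` has eccentricity `d`. -/
theorem Connected.exists_distance_polynomials_of_diametral (hG : G.Connected) {S T : Finset V}
    (hS : ∀ u v, G.Adj u v → (u ∈ S ↔ v ∉ S)) (hT : ∀ v, v ∈ T ↔ v ∉ S) {d : ℕ}
    (hd : ∀ u v, G.dist u v ≤ d) (hspec : (spectrum ℝ (G.adjMatrix ℝ)).ncard = d + 1)
    {x₀ y₀ : V} (hx₀ : x₀ ∈ S) (hxy : G.dist y₀ x₀ = d) {p q : ℝ[X]}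
    (hp : p.degree = (d : WithBot ℕ)) (hq : q.degree = (d : WithBot ℕ))
    (hpS : ∀ x ∈ S, ∀ v, aeval (G.adjMatrix ℝ) p v x = if G.dist v x = d then 1 else 0)
    (hqT : ∀ x ∈ T, ∀ v, aeval (G.adjMatrix ℝ) q v x = if G.dist v x = d then 1 else 0)
    {i : ℕ} (hi : i ≤ d) :
    (∃ r : ℝ[X], r.degree = (i : WithBot ℕ) ∧
      ∀ x ∈ S, ∀ v, aeval (G.adjMatrix ℝ) r v x = if G.dist v x = i then 1 else 0) ∧
    ∃ r : ℝ[X], r.degree = (i : WithBot ℕ) ∧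
      ∀ x ∈ T, ∀ v, aeval (G.adjMatrix ℝ) r v x = if G.dist v x = i then 1 else 0 := by
  obtain ⟨f, hf, hf₀⟩ := G.exists_natDegree_eq_ncard_spectrum_and_aeval_eq_zero
  rw [hspec] at hf
  have hfA (R : Finset V) : ∀ x ∈ R, ∀ v, aeval (G.adjMatrix ℝ) f v x = 0 :=
    fun x _ v => by rw [hf₀, Matrix.zero_apply]
  have hTS : ∀ u v, G.Adj u v → (u ∈ T ↔ v ∉ T) := fun u v huv => by
    have := hS u v huv
    simp only [hT]
    tauto
  have hSi := fun j (hj : j ≤ d) => hG.exists_distance_polynomial hS hf (hfA S) hp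
    (fun x hx v hv => by rw [hpS x hx, if_neg hv.ne]) hx₀ hxy hj
  refine ⟨hSi i hi, ?_⟩
  by_cases h : ∃ x ∈ T, ∃ y, G.dist y x = d
  · obtain ⟨x, hx, y, hyx⟩ := h
    exact hG.exists_distance_polynomial hTS hf (hfA T) hq
      (fun x hx v hv => by rw [hqT x hx, if_neg hv.ne]) hx hyx hi
  · push Not at h
    exact hG.exists_distance_polynomial_compl hS hT hd hx₀ hxy h hq
      (fun y hy v => by rw [hqT y hy, if_neg (h y hy v)]) hSi hi

end SimpleGraph

theorem IsBipartition.adj_mem_iff {V : Type*} {G : SimpleGraph V} {B C : Finset V}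
    (h : IsBipartition G B C) (u v : V) (huv : G.Adj u v) : u ∈ B ↔ v ∉ B := by
  have h₁ := h.2.1 u
  have h₂ := h.2.1 v
  have h₃ := h.2.2 u v huv
  tauto

theorem IsBipartition.mem_right_iff {V : Type*} {G : SimpleGraph V} {B C : Finset V}
    (h : IsBipartition G B C) (v : V) : v ∈ C ↔ v ∉ B := by
  have h₁ := h.1 v
  have h₂ := h.2.1 v
  tauto

theorem IsBipartition.symm {V : Type*} {G : SimpleGraph V} {B C : Finset V}
    (h : IsBipartition G B C) : IsBipartition G C B :=
  ⟨fun v => (h.1 v).symm, fun v hv => h.2.1 v hv.symm, fun u v huv => (h.2.2 u v huv).symm⟩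

theorem distance_biregular_iff_diametral_polynomials
    {V : Type*} [Fintype V] [DecidableEq V] (G : SimpleGraph V) [DecidableRel G.Adj]
    (hconn : G.Connected) (B C : Finset V) (hbip : IsBipartition G B C)
    (d : ℕ) (hd : IsDiam G d) :
    IsDistBiregular G (G.adjMatrix ℝ) B C d ↔
      (spectrum ℝ (G.adjMatrix ℝ)).ncard = d + 1 ∧
        ∃ pB pC : Polynomial ℝ, pB.degree = (d : WithBot ℕ) ∧ pC.degree = (d : WithBot ℕ) ∧
          (∀ b ∈ B, aeval (G.adjMatrix ℝ) pB *ᵥ Pi.single b 1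
              = distMatrix G d *ᵥ Pi.single b 1) ∧
          (∀ c ∈ C, aeval (G.adjMatrix ℝ) pC *ᵥ Pi.single c 1
              = distMatrix G d *ᵥ Pi.single c 1) := by
  constructor
  · rintro ⟨hspec, pB, pC, h⟩
    exact ⟨hspec, pB d, pC d, h d le_rfl⟩
  · rintro ⟨hspec, pB, pC, hB, hC, hpB, hpC⟩
    rw [SimpleGraph.mulVec_single_eq_distMatrix_iff] at hpB hpC
    obtain ⟨hdle, u, v, huv⟩ := hd
    have key (i : ℕ) (hi : i ≤ d) :
        (∃ r : ℝ[X], r.degree = (i : WithBot ℕ) ∧ ∀ b ∈ B, ∀ v,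
          aeval (G.adjMatrix ℝ) r v b = if G.dist v b = i then 1 else 0) ∧
        ∃ r : ℝ[X], r.degree = (i : WithBot ℕ) ∧ ∀ c ∈ C, ∀ v,
          aeval (G.adjMatrix ℝ) r v c = if G.dist v c = i then 1 else 0 := by
      rcases hbip.1 v with hv | hv
      · exact hconn.exists_distance_polynomials_of_diametral hbip.adj_mem_iff
          hbip.mem_right_iff hdle hspec hv huv hB hC hpB hpC hi
      · exact (hconn.exists_distance_polynomials_of_diametral hbip.symm.adj_mem_iff
          hbip.symm.mem_right_iff hdle hspec hv huv hC hB hpC hpB hi).symm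
    choose qB hqB hqB' using fun i hi => (key i hi).1
    choose qC hqC hqC' using fun i hi => (key i hi).2
    refine ⟨hspec, fun i => if hi : i ≤ d then qB i hi else 0,
      fun i => if hi : i ≤ d then qC i hi else 0, fun i hi => ?_⟩
    simp only [dif_pos hi]
    exact ⟨hqB i hi, hqC i hi, SimpleGraph.mulVec_single_eq_distMatrix_iff.mpr (hqB' i hi),
      SimpleGraph.mulVec_single_eq_distMatrix_iff.mpr (hqC' i hi)⟩
end

section
/- Let G be a finite simple connected distance-biregular graph with bipartition (B,C), diameter d, girth at least 2d−2, in which vertices of B have degree k and vertices of C have degree ℓ. Let G' be a finite simple connected (k,ℓ)-semiregular bipartite graph whose adjacency matrix has the same characteristic polynomial as the adjacency matrix of G. Then G' is distance-biregular. -/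
open Polynomial Matrix

namespace Matrix

variable {n m : Type*} [Fintype n] [DecidableEq n] [Fintype m] [DecidableEq m]

theorem IsHermitian.trace_pow_eq_sum_roots {A : Matrix n n ℝ} (hA : A.IsHermitian) (r : ℕ) :
    (A ^ r).trace = (A.charpoly.roots.map (· ^ r)).sum := by
  rw [hA.roots_charpoly_eq_eigenvalues]
  conv_lhs => rw [hA.spectral_theorem, ← map_pow, Unitary.conjStarAlgAut_apply, trace_mul_cycle]
  simp [diagonal_pow, trace_diagonal]

theorem IsSymm.polynomial_aeval {A : Matrix n n ℝ} (hA : A.IsSymm) (p : ℝ[X]) :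
    (Polynomial.aeval A p).IsSymm := by
  induction p using Polynomial.induction_on' with
  | add p q hp hq => rw [map_add]; exact hp.add hq
  | monomial r c =>
    rw [aeval_monomial, ← Algebra.smul_def]
    exact (hA.pow r).smul c

theorem aeval_mul_of_mul_eq_mul {A : Matrix n n ℝ} {E : Matrix n m ℝ} {M : Matrix m m ℝ}
    (h : A * E = E * M) (p : ℝ[X]) : aeval A p * E = E * aeval M p := by
  induction p using Polynomial.induction_on' with
  | add p q hp hq => simp [Matrix.add_mul, Matrix.mul_add, hp, hq]
  | monomial r c =>
    have hpow : A ^ r * E = E * M ^ r := by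
      induction r with
      | zero => simp
      | succ r ih => rw [pow_succ, Matrix.mul_assoc, h, ← Matrix.mul_assoc, ih, Matrix.mul_assoc,
          ← pow_succ]
    simp [aeval_monomial, ← Algebra.smul_def, hpow]

theorem IsSymm.sum_sq_aeval_apply {A : Matrix n n ℝ} (hA : A.IsSymm) (p : ℝ[X]) (b : n) :
    ∑ v, (Polynomial.aeval A p v b) ^ 2 = Polynomial.aeval A (p ^ 2) b b := by
  rw [map_pow, pow_two, Matrix.mul_apply]
  exact Finset.sum_congr rfl fun v _ => by rw [pow_two, ← (hA.polynomial_aeval p).apply v b]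

theorem ncard_spectrum_le_natDegree {A : Matrix n n ℝ} {p : ℝ[X]} (hp : p ≠ 0)
    (h : aeval A p = 0) : (spectrum ℝ A).ncard ≤ p.natDegree := by
  refine le_trans ?_ (p.card_roots'.trans' (Multiset.toFinset_card_le _))
  rw [← Set.ncard_coe_finset]
  refine Set.ncard_le_ncard (fun x hx => ?_) (Finset.finite_toSet _)
  have hx' := spectrum.subset_polynomial_aeval A p ⟨x, hx, rfl⟩
  rw [h] at hx'
  simp only [Finset.mem_coe, Multiset.mem_toFinset, mem_roots hp, IsRoot.def]
  by_contra hne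
  refine hx' ?_
  rw [spectrum.mem_resolventSet_iff, sub_zero]
  exact (IsUnit.mk0 _ hne).map (algebraMap ℝ (Matrix n n ℝ))

end Matrix

/-- `G` is bipartite with parts `B` and `C`, whose vertices have degrees `k` and `ℓ`. -/
structure IsSemiregular {V : Type*} [Fintype V] (G : SimpleGraph V) [DecidableRel G.Adj]
    (B C : Finset V) (k ℓ : ℕ) : Prop where
  bipartition : IsBipartition G B C
  degree_left : ∀ b ∈ B, G.degree b = k
  degree_right : ∀ c ∈ C, G.degree c = ℓ

namespace IsSemiregular

variable {V : Type*} [Fintype V] {G : SimpleGraph V} [DecidableRel G.Adj]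
  {B C : Finset V} {k ℓ : ℕ}

theorem symm (h : IsSemiregular G B C k ℓ) : IsSemiregular G C B ℓ k where
  bipartition := by
    obtain ⟨h₁, h₂, h₃⟩ := h.bipartition
    exact ⟨fun v => (h₁ v).symm, fun v hv => h₂ v hv.symm, fun u v huv => (h₃ u v huv).symm⟩
  degree_left := h.degree_right
  degree_right := h.degree_left

theorem mem_right_iff (h : IsSemiregular G B C k ℓ) (v : V) : v ∈ C ↔ v ∉ B := by
  have := h.bipartition.1 v
  have := h.bipartition.2.1 v
  tauto

theorem mem_left_iff_of_adj (h : IsSemiregular G B C k ℓ) {u v : V} (huv : G.Adj u v) :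
    u ∈ B ↔ v ∉ B := by
  have := h.bipartition.2.2 u v huv
  rw [h.mem_right_iff, h.mem_right_iff] at this
  tauto

variable [DecidableEq V]

theorem sum_diag_pow_left (h : IsSemiregular G B C k ℓ) (r : ℕ) :
    ∑ b ∈ B, (G.adjMatrix ℝ ^ (r + 1)) b b = (G.adjMatrix ℝ ^ (r + 1)).trace / 2 := by
  set A := G.adjMatrix ℝ
  set P : Matrix V V ℝ := diagonal fun v => if v ∈ B then 1 else 0
  have hPA : P * A = A * (1 - P) := by
    ext u v
    simp only [P, Matrix.mul_sub, diagonal_mul, mul_diagonal, Matrix.sub_apply, mul_one,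
      A, SimpleGraph.adjMatrix_apply]
    by_cases huv : G.Adj u v
    · have := h.mem_left_iff_of_adj huv
      by_cases hv : v ∈ B <;> simp_all
    · simp [huv]
  have hP : (P * A ^ (r + 1)).trace = ((1 - P) * A ^ (r + 1)).trace := by
    rw [pow_succ', ← Matrix.mul_assoc, hPA, Matrix.mul_assoc, trace_mul_comm, Matrix.mul_assoc,
      ← pow_succ, pow_succ']
  have hB : (P * A ^ (r + 1)).trace = ∑ b ∈ B, (A ^ (r + 1)) b b := by
    simp [P, trace, diagonal_mul]
  rw [Matrix.sub_mul, Matrix.one_mul, trace_sub] at hP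
  linarith

theorem card_left_mul (h : IsSemiregular G B C k ℓ) :
    (B.card : ℝ) * k = (G.adjMatrix ℝ ^ 2).trace / 2 := by
  rw [← h.sum_diag_pow_left 1, Finset.sum_congr rfl (g := fun _ => (k : ℝ))]
  · simp
  · intro b hb
    rw [pow_two, SimpleGraph.adjMatrix_mul_self_apply_self, h.degree_left b hb]

theorem card_add_card (h : IsSemiregular G B C k ℓ) : B.card + C.card = Fintype.card V := by
  have : C = Bᶜ := by ext v; simp [h.mem_right_iff]
  rw [this, Finset.card_add_card_compl]

/-- The quotient matrix of the partition of the vertices into the two parts. -/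
def quotientMatrix (k ℓ : ℕ) : Matrix Bool Bool ℝ :=
  Matrix.of fun i j => if i = j then 0 else cond i (k : ℝ) ℓ

theorem sum_sum_aeval (h : IsSemiregular G B C k ℓ) (p : ℝ[X]) (i : Bool) :
    ∑ b ∈ B, ∑ v ∈ cond i B C, aeval (G.adjMatrix ℝ) p v b =
      (cond i B C).card * aeval (quotientMatrix k ℓ) p i true := by
  let E : Matrix V Bool ℝ := Matrix.of fun v j => if v ∈ cond j B C then 1 else 0
  have hE : G.adjMatrix ℝ * E = E * quotientMatrix k ℓ := by
    ext v j
    have hnbr : ∀ u ∈ G.neighborFinset v, (u ∈ cond j B C ↔ v ∉ cond j B C) := fun u hu => by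
      have := h.mem_left_iff_of_adj ((G.mem_neighborFinset v u).mp hu)
      cases j <;> simp only [cond_true, cond_false, h.mem_right_iff] <;> tauto
    have hdeg : v ∉ cond j B C → G.degree v = cond (!j) k ℓ := fun hv => by
      cases j
      · exact h.degree_left v (by simpa [h.mem_right_iff] using hv)
      · exact h.degree_right v (by simpa [h.mem_right_iff] using hv)
    have hother : v ∈ cond (!j) B C ↔ v ∉ cond j B C := by
      cases j <;> simp [h.mem_right_iff]
    refine (SimpleGraph.adjMatrix_mulVec_apply G v fun u => E u j).trans ?_
    trans if v ∈ cond j B C then 0 else ((cond (!j) k ℓ : ℕ) : ℝ)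
    · simp only [E, of_apply]
      rw [Finset.sum_congr rfl fun u hu => if_congr (hnbr u hu) rfl rfl]
      by_cases hv : v ∈ cond j B C
      · simp [hv]
      · simp [hv, ← hdeg hv]
    · by_cases hv : v ∈ cond j B C <;> cases j <;>
        simp_all [E, Matrix.mul_apply, quotientMatrix]
  have hsum : Eᵀ * (aeval (G.adjMatrix ℝ) p * E) = Eᵀ * E * aeval (quotientMatrix k ℓ) p := by
    rw [aeval_mul_of_mul_eq_mul hE p, Matrix.mul_assoc]
  have hEE : Eᵀ * E = diagonal fun i => ((cond i B C).card : ℝ) := by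
    ext i j
    have hdisj : ∀ v, ¬(v ∈ B ∧ v ∈ C) := h.bipartition.2.1
    have hdisj' : ∀ v, ¬(v ∈ C ∧ v ∈ B) := fun v hv => hdisj v hv.symm
    rw [Matrix.mul_apply, diagonal_apply]
    cases i <;> cases j <;> simp [E, ← ite_and, hdisj, hdisj']
  have hentry := congr_fun₂ hsum i true
  rw [hEE, diagonal_mul] at hentry
  rw [← hentry, Matrix.mul_apply, Finset.sum_comm]
  simp [E, Matrix.mul_apply]

end IsSemiregular

/-- The polynomial invariants, restricted to one part of each of two bipartite graphs, that are
shared by cospectral semiregular graphs. -/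
structure SpectralMatch {V V' : Type*} [Fintype V] [DecidableEq V] [Fintype V'] [DecidableEq V']
    (G : SimpleGraph V) [DecidableRel G.Adj] (G' : SimpleGraph V') [DecidableRel G'.Adj]
    (B C : Finset V) (B' C' : Finset V') : Prop where
  sum_sq : ∀ p : ℝ[X], ∑ b ∈ B', ∑ v, (aeval (G'.adjMatrix ℝ) p v b) ^ 2 =
    ∑ b ∈ B, ∑ v, (aeval (G.adjMatrix ℝ) p v b) ^ 2
  sum_part : ∀ (p : ℝ[X]) (i : Bool), ∑ b ∈ B', ∑ v ∈ cond i B' C', aeval (G'.adjMatrix ℝ) p v b =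
    ∑ b ∈ B, ∑ v ∈ cond i B C, aeval (G.adjMatrix ℝ) p v b
  card_part : ∀ i : Bool, (cond i B' C').card = (cond i B C).card

theorem IsBipartition.sum_add_sum {V : Type*} [Fintype V] {G : SimpleGraph V} {B C : Finset V}
    (h : IsBipartition G B C) (f : V → ℝ) : ∑ v ∈ B, f v + ∑ v ∈ C, f v = ∑ v, f v := by
  classical
  rw [← Finset.sum_union (Finset.disjoint_left.mpr fun v hB hC => h.2.1 v ⟨hB, hC⟩)]
  congr 1
  ext v
  simpa using h.1 v

theorem sum_sum_sub_indicator_sq {W : Type*} [Fintype W] [DecidableEq W] (S D : Finset W)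
    (M : Matrix W W ℝ) :
    ∑ b ∈ S, ∑ v, (M v b - if v ∈ D then 1 else 0) ^ 2 =
      ∑ b ∈ S, ∑ v, M v b ^ 2 - 2 * ∑ b ∈ S, ∑ v ∈ D, M v b + S.card * D.card := by
  have (x : ℝ) (v : W) : (x - if v ∈ D then 1 else 0) ^ 2 =
      x ^ 2 - 2 * (if v ∈ D then x else 0) + if v ∈ D then 1 else 0 := by
    split_ifs <;> ring
  simp [this, Finset.sum_add_distrib, Finset.sum_sub_distrib, Finset.mul_sum]

section Match

variable {V V' : Type*} [Fintype V] [DecidableEq V] [Fintype V'] [DecidableEq V']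
  {G : SimpleGraph V} [DecidableRel G.Adj] {G' : SimpleGraph V'} [DecidableRel G'.Adj]
  {B C : Finset V} {B' C' : Finset V'} {k ℓ : ℕ}

theorem IsSemiregular.spectralMatch (h : IsSemiregular G B C k ℓ)
    (h' : IsSemiregular G' B' C' k ℓ) (hk : k ≠ 0)
    (hχ : (G'.adjMatrix ℝ).charpoly = (G.adjMatrix ℝ).charpoly) :
    SpectralMatch G G' B C B' C' := by
  have hA : (G.adjMatrix ℝ).IsHermitian := G.isSymm_adjMatrix
  have hA' : (G'.adjMatrix ℝ).IsHermitian := G'.isSymm_adjMatrix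
  have htr (r : ℕ) : (G'.adjMatrix ℝ ^ r).trace = (G.adjMatrix ℝ ^ r).trace := by
    rw [hA.trace_pow_eq_sum_roots, hA'.trace_pow_eq_sum_roots, hχ]
  have hB : B'.card = B.card := by
    have := h'.card_left_mul.trans ((congr_arg (· / 2) (htr 2)).trans h.card_left_mul.symm)
    exact_mod_cast mul_right_cancel₀ (Nat.cast_ne_zero.mpr hk) this
  have hV : Fintype.card V' = Fintype.card V := by
    rw [← (G'.adjMatrix ℝ).charpoly_natDegree_eq_dim, hχ, charpoly_natDegree_eq_dim]
  have hcard : ∀ i : Bool, (cond i B' C').card = (cond i B C).card := by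
    have := h.card_add_card
    have := h'.card_add_card
    rintro (_ | _) <;> simp only [cond_true, cond_false] <;> omega
  refine ⟨fun p => ?_, fun p i => ?_, hcard⟩
  · simp only [G.isSymm_adjMatrix.sum_sq_aeval_apply, G'.isSymm_adjMatrix.sum_sq_aeval_apply]
    induction p ^ 2 using Polynomial.induction_on' with
    | add p q hp hq => simp [Finset.sum_add_distrib, hp, hq]
    | monomial r c =>
      simp only [aeval_monomial, ← Algebra.smul_def, Matrix.smul_apply, smul_eq_mul,
        ← Finset.mul_sum]
      cases r with
      | zero => simp [hB]
      | succ r => rw [h.sum_diag_pow_left, h'.sum_diag_pow_left, htr]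
  · rw [h.sum_sum_aeval, h'.sum_sum_aeval, hcard]

namespace SpectralMatch

theorem aeval_apply_eq_zero (hm : SpectralMatch G G' B C B' C') {p : ℝ[X]}
    (hp : ∀ b ∈ B, ∀ v, aeval (G.adjMatrix ℝ) p v b = 0) :
    ∀ b ∈ B', ∀ v, aeval (G'.adjMatrix ℝ) p v b = 0 := by
  have hsum := hm.sum_sq p
  rw [Finset.sum_eq_zero (s := B) fun b hb => by simp [hp b hb]] at hsum
  intro b hb v
  have := (Finset.sum_eq_zero_iff_of_nonneg fun b _ => by positivity).mp hsum b hb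
  have := (Finset.sum_eq_zero_iff_of_nonneg fun b _ => by positivity).mp this v
    (Finset.mem_univ v)
  exact pow_eq_zero_iff two_ne_zero |>.mp this

/-- Columns of `p(A)` that are `0`-`1` vectors stay so, if they have natural number entries. -/
theorem aeval_apply_le_one (hm : SpectralMatch G G' B C B' C') (hb : IsBipartition G B C)
    (hb' : IsBipartition G' B' C') {p : ℝ[X]}
    (hp : ∀ b ∈ B, ∀ v, aeval (G.adjMatrix ℝ) p v b = 0 ∨ aeval (G.adjMatrix ℝ) p v b = 1)
    (hp' : ∀ b ∈ B', ∀ v, ∃ x : ℕ, aeval (G'.adjMatrix ℝ) p v b = x) :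
    ∀ b ∈ B', ∀ v, aeval (G'.adjMatrix ℝ) p v b ≤ 1 := by
  have hsum : ∑ b ∈ B', ∑ v, (aeval (G'.adjMatrix ℝ) p v b ^ 2 - aeval (G'.adjMatrix ℝ) p v b) =
      ∑ b ∈ B, ∑ v, (aeval (G.adjMatrix ℝ) p v b ^ 2 - aeval (G.adjMatrix ℝ) p v b) := by
    have htrue := hm.sum_part p true
    have hfalse := hm.sum_part p false
    simp only [cond_true, cond_false] at htrue hfalse
    simp only [Finset.sum_sub_distrib, hm.sum_sq]
    simp only [← hb.sum_add_sum fun v => aeval (G.adjMatrix ℝ) p v _,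
      ← hb'.sum_add_sum fun v => aeval (G'.adjMatrix ℝ) p v _,
      Finset.sum_add_distrib, htrue, hfalse]
  rw [Finset.sum_eq_zero (s := B) fun b hb => Finset.sum_eq_zero fun v _ => by
    rcases hp b hb v with h | h <;> simp [h]] at hsum
  have hnonneg : ∀ b ∈ B', ∀ v,
      0 ≤ aeval (G'.adjMatrix ℝ) p v b ^ 2 - aeval (G'.adjMatrix ℝ) p v b := fun b hb v => by
    obtain ⟨x, hx⟩ := hp' b hb v
    rw [hx, sub_nonneg]
    exact_mod_cast Nat.le_self_pow two_ne_zero x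
  intro b hb v
  have hcol := (Finset.sum_eq_zero_iff_of_nonneg fun b hb =>
    Finset.sum_nonneg fun v _ => hnonneg b hb v).mp hsum b hb
  have hentry := (Finset.sum_eq_zero_iff_of_nonneg fun v _ => hnonneg b hb v).mp hcol v
    (Finset.mem_univ v)
  nlinarith

theorem aeval_apply_eq_indicator (hm : SpectralMatch G G' B C B' C') {p : ℝ[X]} (i : Bool)
    (hp : ∀ b ∈ B, ∀ v, aeval (G.adjMatrix ℝ) p v b = if v ∈ cond i B C then 1 else 0) :
    ∀ b ∈ B', ∀ v, aeval (G'.adjMatrix ℝ) p v b = if v ∈ cond i B' C' then 1 else 0 := by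
  have hsum := sum_sum_sub_indicator_sq B' (cond i B' C') (aeval (G'.adjMatrix ℝ) p)
  rw [hm.sum_sq, hm.sum_part, hm.card_part, show B'.card = B.card from hm.card_part true,
    ← sum_sum_sub_indicator_sq,
    Finset.sum_eq_zero (s := B) fun b hb => Finset.sum_eq_zero fun v _ => by simp [hp b hb]] at hsum
  intro b hb v
  have hcol := (Finset.sum_eq_zero_iff_of_nonneg fun b _ => by positivity).mp hsum b hb
  have hentry := (Finset.sum_eq_zero_iff_of_nonneg fun v _ => by positivity).mp hcol v
    (Finset.mem_univ v)
  exact sub_eq_zero.mp (pow_eq_zero_iff two_ne_zero |>.mp hentry)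

end SpectralMatch

end Match

namespace SimpleGraph

variable {V : Type*} {G : SimpleGraph V}

theorem egirth_le_of_isPath_ne {u v : V} {p q : G.Walk u v} (hp : p.IsPath) (hq : q.IsPath)
    (hpq : p ≠ q) : G.egirth ≤ (p.length + q.length : ℕ) := by
  classical
  let s : Finset (Sym2 V) := p.edges.toFinset ∪ q.edges.toFinset
  let H : SimpleGraph V := fromEdgeSet (s : Set (Sym2 V))
  have hmem : ∀ e ∈ s, e ∈ G.edgeSet := fun e he => by
    simp only [s, Finset.mem_union, List.mem_toFinset] at he
    exact he.elim (fun h => p.edges_subset_edgeSet h) fun h => q.edges_subset_edgeSet h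
  have hHs : ∀ e, e ∈ H.edgeSet ↔ e ∈ s := fun e => by
    simp only [H, edgeSet_fromEdgeSet, Set.mem_sdiff, Finset.mem_coe]
    exact ⟨fun h => h.1, fun h => ⟨h, G.not_isDiag_of_mem_edgeSet (hmem e h)⟩⟩
  have hHG : H ≤ G := edgeSet_subset_edgeSet.mp fun e he => hmem e ((hHs e).mp he)
  have hpH : ∀ e ∈ p.edges, e ∈ H.edgeSet := fun e he => (hHs e).mpr <| by simp [s, he]
  have hqH : ∀ e ∈ q.edges, e ∈ H.edgeSet := fun e he => (hHs e).mpr <| by simp [s, he]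
  have hacyc : ¬ H.IsAcyclic := fun hac => hpq <| by
    have := (hac.subsingleton_path u v).elim ⟨p.transfer H hpH, hp.transfer hpH⟩
      ⟨q.transfer H hqH, hq.transfer hqH⟩
    have := congr_arg (fun r : H.Path u v => r.1.transfer G fun e he =>
      edgeSet_mono hHG (r.1.edges_subset_edgeSet he)) this
    simpa only [Walk.transfer_transfer, Walk.transfer_self] using this
  simp only [IsAcyclic, not_forall, not_not] at hacyc
  obtain ⟨a, c, hc⟩ := hacyc
  refine (egirth_le_length ((Walk.isCycle_mapLe hHG).mpr hc)).trans ?_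
  rw [Nat.cast_le, Walk.length_map, ← c.length_edges,
    ← List.toFinset_card_of_nodup hc.isTrail.edges_nodup]
  calc _ ≤ s.card := Finset.card_le_card fun e he =>
        (hHs e).mp (c.edges_subset_edgeSet (List.mem_toFinset.mp he))
    _ ≤ _ := (Finset.card_union_le _ _).trans <| by
        rw [← p.length_edges, ← q.length_edges]
        exact Nat.add_le_add (List.toFinset_card_le _) (List.toFinset_card_le _)

theorem Connected.egirth_le_of_two_predecessors (hG : G.Connected) {b v w w' : V} {i : ℕ}
    (hv : G.dist b v = i + 1) (hw : G.dist b w = i) (hw' : G.dist b w' = i)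
    (h : G.Adj w v) (h' : G.Adj w' v) (hne : w ≠ w') : G.egirth ≤ (2 * (i + 1) : ℕ) := by
  obtain ⟨p, hp⟩ := hG.exists_walk_length_eq_dist b w
  obtain ⟨q, hq⟩ := hG.exists_walk_length_eq_dist b w'
  have hpl : (p.concat h).length = i + 1 := by rw [Walk.length_concat, hp, hw]
  have hql : (q.concat h').length = i + 1 := by rw [Walk.length_concat, hq, hw']
  have := egirth_le_of_isPath_ne ((p.concat h).isPath_of_length_eq_dist (hpl.trans hv.symm))
    ((q.concat h').isPath_of_length_eq_dist (hql.trans hv.symm))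
    fun he => hne <| by simpa using congr_arg Walk.penultimate he
  rwa [hpl, hql, ← two_mul] at this

variable [Fintype V] [DecidableRel G.Adj]

variable (G) in
/-- The number of neighbors of `v` at distance `i` from `b`. -/
noncomputable def neighborsAtDist (b v : V) (i : ℕ) : ℕ :=
  ((G.neighborFinset v).filter fun w => G.dist b w = i).card

theorem neighborsAtDist_eq_zero {b v : V} {i : ℕ}
    (h : ∀ w, G.Adj v w → G.dist b w ≠ i) : G.neighborsAtDist b v i = 0 := by
  rw [neighborsAtDist, Finset.card_eq_zero, Finset.filter_eq_empty_iff]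
  exact fun w hw => h w ((G.mem_neighborFinset v w).mp hw)

theorem Connected.one_le_neighborsAtDist (hG : G.Connected) {b v : V} {i : ℕ}
    (h : G.dist b v = i + 1) : 1 ≤ G.neighborsAtDist b v i := by
  obtain ⟨p, hp⟩ := hG.exists_walk_length_eq_dist v b
  rw [dist_comm, h] at hp
  cases p with
  | nil => simp at hp
  | @cons _ w _ hadj p =>
    have hle := dist_le p
    have htri := hG.dist_triangle (u := b) (v := w) (w := v)
    rw [dist_eq_one_iff_adj.mpr hadj.symm, h] at htri
    rw [dist_comm] at hle
    rw [Walk.length_cons] at hp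
    exact Finset.card_pos.mpr ⟨w, by
      simp only [Finset.mem_filter, mem_neighborFinset, hadj, true_and]; omega⟩

theorem Connected.neighborsAtDist_eq_one (hG : G.Connected) {b v : V} {i : ℕ}
    (h : G.dist b v = i + 1) (hgirth : (2 * (i + 1) : ℕ) < G.egirth) :
    G.neighborsAtDist b v i = 1 := by
  refine le_antisymm (Finset.card_le_one.mpr fun w hw w' hw' => ?_) (hG.one_le_neighborsAtDist h)
  simp only [Finset.mem_filter, mem_neighborFinset] at hw hw'
  by_contra hne
  exact hgirth.not_ge (hG.egirth_le_of_two_predecessors h hw.2 hw'.2 hw.1.symm hw'.1.symm hne)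

theorem neighborsAtDist_add_neighborsAtDist {b v : V} {i j : ℕ} (hij : i ≠ j)
    (h : ∀ w, G.Adj v w → G.dist b w = i ∨ G.dist b w = j) :
    G.neighborsAtDist b v i + G.neighborsAtDist b v j = G.degree v := by
  classical
  rw [neighborsAtDist, neighborsAtDist, ← Finset.card_union_of_disjoint, ← Finset.filter_or,
    ← card_neighborFinset_eq_degree, Finset.filter_true_of_mem]
  · exact fun w hw => h w ((G.mem_neighborFinset v w).mp hw)
  · exact Finset.disjoint_filter.mpr fun w _ h₁ h₂ => hij (h₁.symm.trans h₂)

end SimpleGraph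

/-- The number of neighbors at distance `i + 1` from a vertex `b` of degree `k`, for a vertex
at distance `i` from `b` with at most one predecessor. -/
noncomputable def branching (k ℓ i : ℕ) : ℝ :=
  (if Even i then (k : ℝ) else ℓ) - if i = 0 then 0 else 1

namespace IsSemiregular

variable {V : Type*} [Fintype V] {G : SimpleGraph V} [DecidableRel G.Adj]
  {B C : Finset V} {k ℓ : ℕ}

theorem even_length_iff (h : IsSemiregular G B C k ℓ) {u v : V} (p : G.Walk u v) :
    Even p.length ↔ (u ∈ B ↔ v ∈ B) := by
  induction p with
  | nil => simp
  | cons hadj p ih =>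
    rw [SimpleGraph.Walk.length_cons, Nat.even_add_one, ih, h.mem_left_iff_of_adj hadj]
    tauto

theorem even_dist_iff (h : IsSemiregular G B C k ℓ) (hG : G.Connected) {b : V} (hb : b ∈ B)
    (v : V) : Even (G.dist b v) ↔ v ∈ B := by
  obtain ⟨p, hp⟩ := hG.exists_walk_length_eq_dist b v
  rw [← hp, h.even_length_iff p]
  simp [hb]

theorem dist_of_adj (h : IsSemiregular G B C k ℓ) (hG : G.Connected) {b v w : V} (hb : b ∈ B)
    (hadj : G.Adj v w) : G.dist b w = G.dist b v + 1 ∨ G.dist b v = G.dist b w + 1 := by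
  have hparity := h.mem_left_iff_of_adj hadj
  rw [← h.even_dist_iff hG hb, ← h.even_dist_iff hG hb] at hparity
  rcases hadj.diff_dist_adj (u := b) with hd | hd | hd
  · rw [hd] at hparity; tauto
  · exact .inl hd
  · by_cases h0 : G.dist b v = 0
    · simp [h0, hd] at hparity
    · omega

/-- If all vertices at distance `i` from `b` have a unique predecessor, then the number of
neighbors at distance `i + 1` is constant on them. -/
theorem neighborsAtDist_succ (h : IsSemiregular G B C k ℓ) (hG : G.Connected) {b : V}
    (hb : b ∈ B) {i : ℕ}
    (hpred : ∀ j v, i = j + 1 → G.dist b v = i → G.neighborsAtDist b v j = 1) (v : V) :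
    (G.neighborsAtDist b v (i + 1) : ℝ) =
      (if G.dist b v = i + 2 then (G.neighborsAtDist b v (i + 1) : ℝ) else 0) +
      if G.dist b v = i then branching k ℓ i else 0 := by
  have hadj := fun w (hw : G.Adj v w) => h.dist_of_adj hG hb hw
  by_cases hv : G.dist b v = i + 2
  · simp [hv]
  rw [if_neg hv, zero_add]
  by_cases hi : G.dist b v = i
  · have hdeg : (G.degree v : ℝ) = if Even i then (k : ℝ) else ℓ := by
      have := h.even_dist_iff hG hb v
      rw [hi] at this
      split_ifs with heven
      · rw [h.degree_left v (this.mp heven)]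
      · rw [h.degree_right v ((h.mem_right_iff v).mpr (mt this.mpr heven))]
    rw [if_pos hi, branching, ← hdeg]
    rcases i with _ | j
    · rw [← SimpleGraph.neighborsAtDist_add_neighborsAtDist (b := b) (i := 1) (j := 0) (by simp)
        fun w hw => by have := hadj w hw; omega,
        SimpleGraph.neighborsAtDist_eq_zero (i := 0) fun w hw => by have := hadj w hw; omega]
      simp
    · rw [← SimpleGraph.neighborsAtDist_add_neighborsAtDist (b := b) (i := j + 2) (j := j)
        (by simp) fun w hw => by have := hadj w hw; omega, hpred j v rfl hi]
      simp
  · rw [if_neg hi, SimpleGraph.neighborsAtDist_eq_zero fun w hw => by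
      have := hadj w hw; omega, Nat.cast_zero]

end IsSemiregular

section DistancePolynomial

variable {V : Type*} [Fintype V] {G : SimpleGraph V} [DecidableRel G.Adj]
  {B C : Finset V} {k ℓ : ℕ}

/-- The vertices at distance `i` from a vertex of `B` have a unique predecessor. -/
def HasUniquePredecessors (G : SimpleGraph V) [DecidableRel G.Adj] (B : Finset V) (i : ℕ) :
    Prop :=
  ∀ b ∈ B, ∀ j v, i = j + 1 → G.dist b v = i → G.neighborsAtDist b v j = 1

theorem hasUniquePredecessors_zero : HasUniquePredecessors G B 0 :=
  fun _ _ _ _ h => absurd h.symm (Nat.succ_ne_zero _)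

theorem hasUniquePredecessors_one (hG : G.Connected) : HasUniquePredecessors G B 1 := by
  rintro b _ j v hj hv
  obtain rfl : j = 0 := by omega
  refine le_antisymm (Finset.card_le_one.mpr fun w hw w' hw' => ?_) (hG.one_le_neighborsAtDist hv)
  simp only [Finset.mem_filter, hG.dist_eq_zero_iff] at hw hw'
  exact hw.2.symm.trans hw'.2

theorem hasUniquePredecessors_of_lt_egirth (hG : G.Connected) {i : ℕ}
    (hi : (2 * i : ℕ) < G.egirth) : HasUniquePredecessors G B i := by
  rintro b _ j v rfl hv
  exact hG.neighborsAtDist_eq_one hv hi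

theorem IsSemiregular.mem_cond_iff (h : IsSemiregular G B C k ℓ) (hG : G.Connected) {b : V}
    (hb : b ∈ B) (v : V) (e : ℕ) :
    v ∈ cond (decide (Even e)) B C ↔ (Even (G.dist b v) ↔ Even e) := by
  rw [h.even_dist_iff hG hb]
  by_cases he : Even e <;> simp [he, h.mem_right_iff]

variable [DecidableEq V]

theorem SimpleGraph.dist_le_natDegree {p : ℝ[X]} {u v : V}
    (h : aeval (G.adjMatrix ℝ) p u v ≠ 0) : G.dist u v ≤ p.natDegree := by
  rw [aeval_eq_sum_range, Matrix.sum_apply] at h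
  obtain ⟨i, hi, hne⟩ := Finset.exists_ne_zero_of_sum_ne_zero h
  rw [Matrix.smul_apply, SimpleGraph.adjMatrix_pow_apply_eq_card_walk] at hne
  have hcard : Fintype.card {w : G.Walk u v | w.length = i} ≠ 0 := fun h0 => hne (by simp [h0])
  obtain ⟨w, hw⟩ := Fintype.card_pos_iff.mp (Nat.pos_of_ne_zero hcard)
  have hw : w.length = i := hw
  have := SimpleGraph.dist_le w
  have := Finset.mem_range.mp hi
  omega

/-- `p` evaluates to the distance-`i` matrix on the columns indexed by `B`. -/
def IsDistPolynomial (G : SimpleGraph V) [DecidableRel G.Adj] (B : Finset V) (i : ℕ)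
    (p : ℝ[X]) : Prop :=
  ∀ b ∈ B, ∀ v, aeval (G.adjMatrix ℝ) p v b = if G.dist b v = i then 1 else 0

theorem isDistPolynomial_iff {i : ℕ} {p : ℝ[X]} :
    IsDistPolynomial G B i p ↔ ∀ b ∈ B, aeval (G.adjMatrix ℝ) p *ᵥ Pi.single b 1 =
      distMatrix G i *ᵥ Pi.single b 1 := by
  simp [IsDistPolynomial, funext_iff, distMatrix, SimpleGraph.dist_comm]

theorem isDistPolynomial_zero_one (hG : G.Connected) : IsDistPolynomial G B 0 1 := by
  intro b _ v
  simp [Matrix.one_apply, hG.dist_eq_zero_iff, eq_comm]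

theorem isDistPolynomial_one_X : IsDistPolynomial G B 1 X := by
  intro b _ v
  simp [SimpleGraph.dist_eq_one_iff_adj, SimpleGraph.adj_comm]

theorem IsDistPolynomial.aeval_X_mul_apply {i : ℕ} {p : ℝ[X]} (hp : IsDistPolynomial G B i p)
    {b : V} (hb : b ∈ B) (v : V) :
    aeval (G.adjMatrix ℝ) (X * p) v b = G.neighborsAtDist b v i := by
  rw [map_mul, aeval_X, SimpleGraph.adjMatrix_mul_apply, Finset.sum_congr rfl fun w _ => hp b hb w,
    SimpleGraph.neighborsAtDist, Finset.sum_boole]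

theorem IsSemiregular.aeval_recurrence_apply (h : IsSemiregular G B C k ℓ) (hG : G.Connected)
    {i : ℕ} {p q : ℝ[X]} (hp : IsDistPolynomial G B i p) (hq : IsDistPolynomial G B (i + 1) q)
    (hpred : HasUniquePredecessors G B i) {b : V} (hb : b ∈ B) (v : V) :
    aeval (G.adjMatrix ℝ) (X * q - Polynomial.C (branching k ℓ i) * p) v b =
      if G.dist b v = i + 2 then (G.neighborsAtDist b v (i + 1) : ℝ) else 0 := by
  rw [map_sub, Matrix.sub_apply, hq.aeval_X_mul_apply hb, map_mul, aeval_C, ← Algebra.smul_def,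
    Matrix.smul_apply, hp b hb v, smul_eq_mul, mul_ite, mul_one, mul_zero, sub_eq_iff_eq_add]
  exact h.neighborsAtDist_succ hG hb (hpred b hb) v

end DistancePolynomial

section Transfer

variable {V V' : Type*} [Fintype V] [DecidableEq V] [Fintype V'] [DecidableEq V']
  {G : SimpleGraph V} [DecidableRel G.Adj] {G' : SimpleGraph V'} [DecidableRel G'.Adj]
  {B C : Finset V} {B' C' : Finset V'} {k ℓ : ℕ}

namespace SpectralMatch

theorem isDistPolynomial_of_isDistPolynomial (hm : SpectralMatch G G' B C B' C') {i : ℕ}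
    {p q : ℝ[X]} (hp : IsDistPolynomial G B i p) (hq : IsDistPolynomial G B i q)
    (hq' : IsDistPolynomial G' B' i q) : IsDistPolynomial G' B' i p := by
  intro b hb v
  have := hm.aeval_apply_eq_zero (p := p - q) (fun b hb v => by
    rw [map_sub, Matrix.sub_apply, hp b hb v, hq b hb v, sub_self]) b hb v
  rw [map_sub, Matrix.sub_apply, sub_eq_zero] at this
  rw [this, hq' b hb v]

theorem isDistPolynomial_add_two (hm : SpectralMatch G G' B C B' C')
    (h : IsSemiregular G B C k ℓ) (h' : IsSemiregular G' B' C' k ℓ) (hG : G.Connected)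
    (hG' : G'.Connected) {i : ℕ} {p q r : ℝ[X]} (hp : IsDistPolynomial G B i p)
    (hq : IsDistPolynomial G B (i + 1) q) (hr : IsDistPolynomial G B (i + 2) r)
    (hpred : HasUniquePredecessors G B i) (hpred₂ : HasUniquePredecessors G B (i + 2))
    (hp' : IsDistPolynomial G' B' i p) (hq' : IsDistPolynomial G' B' (i + 1) q)
    (hpred' : HasUniquePredecessors G' B' i) :
    IsDistPolynomial G' B' (i + 2) r ∧ HasUniquePredecessors G' B' (i + 2) := by
  set s : ℝ[X] := X * q - Polynomial.C (branching k ℓ i) * p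
  have hs : IsDistPolynomial G B (i + 2) s := fun b hb v => by
    rw [h.aeval_recurrence_apply hG hp hq hpred hb]
    split_ifs with hv
    · rw [hpred₂ b hb (i + 1) v rfl hv, Nat.cast_one]
    · rfl
  have hs' (b) (hb : b ∈ B') (v) : aeval (G'.adjMatrix ℝ) s v b =
      if G'.dist b v = i + 2 then (G'.neighborsAtDist b v (i + 1) : ℝ) else 0 :=
    h'.aeval_recurrence_apply hG' hp' hq' hpred' hb v
  have hle := hm.aeval_apply_le_one h.bipartition h'.bipartition (p := s)
    (fun b hb v => by rw [hs b hb v]; split_ifs <;> simp)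
    (fun b hb v => by
      rw [hs' b hb v]
      split_ifs
      · exact ⟨_, rfl⟩
      · exact ⟨0, Nat.cast_zero.symm⟩)
  have hpred₂' : HasUniquePredecessors G' B' (i + 2) := by
    intro b hb j v hj hv
    obtain rfl : j = i + 1 := by omega
    have := hle b hb v
    rw [hs' b hb v, if_pos hv] at this
    exact le_antisymm (by exact_mod_cast this) (hG'.one_le_neighborsAtDist hv)
  refine ⟨hm.isDistPolynomial_of_isDistPolynomial hr hs fun b hb v => ?_, hpred₂'⟩
  rw [hs' b hb v]
  split_ifs with hv
  · rw [hpred₂' b hb (i + 1) v rfl hv, Nat.cast_one]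
  · rfl

theorem isDistPolynomial_of_add_two_le (hm : SpectralMatch G G' B C B' C')
    (h : IsSemiregular G B C k ℓ) (h' : IsSemiregular G' B' C' k ℓ) (hG : G.Connected)
    (hG' : G'.Connected) {d : ℕ} (hgirth : ((2 * d - 2 : ℕ) : ℕ∞) ≤ G.egirth) {p : ℕ → ℝ[X]}
    (hp : ∀ i ≤ d, IsDistPolynomial G B i (p i)) {i : ℕ} (hi : i + 2 ≤ d) :
    IsDistPolynomial G' B' i (p i) := by
  have hpred {i : ℕ} (hi : i + 2 ≤ d) : HasUniquePredecessors G B i :=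
    hasUniquePredecessors_of_lt_egirth hG (lt_of_lt_of_le (by norm_cast; omega) hgirth)
  have hzero : IsDistPolynomial G' B' 0 (p 0) :=
    hm.isDistPolynomial_of_isDistPolynomial (hp 0 (by omega)) (isDistPolynomial_zero_one hG)
      (isDistPolynomial_zero_one hG')
  have key (i : ℕ) (hi : i + 3 ≤ d) : IsDistPolynomial G' B' i (p i) ∧
      IsDistPolynomial G' B' (i + 1) (p (i + 1)) ∧ HasUniquePredecessors G' B' i ∧
      HasUniquePredecessors G' B' (i + 1) := by
    induction i with
    | zero => exact ⟨hzero, hm.isDistPolynomial_of_isDistPolynomial (hp 1 (by omega))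
        isDistPolynomial_one_X isDistPolynomial_one_X, hasUniquePredecessors_zero,
        hasUniquePredecessors_one hG'⟩
    | succ i ih =>
      obtain ⟨hi₀, hi₁, hpred₀, hpred₁⟩ := ih (by omega)
      obtain ⟨hi₂, hpred₂⟩ := hm.isDistPolynomial_add_two h h' hG hG' (hp i (by omega))
        (hp (i + 1) (by omega)) (hp (i + 2) (by omega)) (hpred (by omega)) (hpred (by omega))
        hi₀ hi₁ hpred₀
      exact ⟨hi₁, hi₂, hpred₁, hpred₂⟩
  rcases i with _ | i
  · exact hzero
  · exact (key i (by omega)).2.1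

end SpectralMatch

/-- The sum of those of the first `e + 1` polynomials whose index has the parity of `e`. -/
noncomputable def paritySum (p : ℕ → ℝ[X]) (e : ℕ) : ℝ[X] :=
  ∑ i ∈ (Finset.range (e + 1)).filter fun i => (Even i ↔ Even e), p i

theorem paritySum_eq (p : ℕ → ℝ[X]) (e : ℕ) :
    paritySum p e = p e + ∑ i ∈ (Finset.range e).filter fun i => (Even i ↔ Even e), p i := by
  rw [paritySum, Finset.range_add_one, Finset.filter_insert, if_pos Iff.rfl,
    Finset.sum_insert (by simp)]

theorem natDegree_paritySum_le {p : ℕ → ℝ[X]} {e : ℕ} (hp : ∀ i ≤ e, (p i).natDegree ≤ i) :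
    (paritySum p e).natDegree ≤ e :=
  natDegree_sum_le_of_forall_le _ _ fun i hi => by
    have hi : i ≤ e := Nat.lt_succ_iff.mp (Finset.mem_range.mp (Finset.mem_filter.mp hi).1)
    exact (hp i hi).trans hi

theorem sum_aeval_apply_of_isDistPolynomial {p : ℕ → ℝ[X]} {s : Finset ℕ}
    (hp : ∀ i ∈ s, IsDistPolynomial G B i (p i)) {b : V} (hb : b ∈ B) (v : V) :
    aeval (G.adjMatrix ℝ) (∑ i ∈ s, p i) v b = if G.dist b v ∈ s then 1 else 0 := by
  rw [map_sum, Matrix.sum_apply, Finset.sum_congr rfl fun i hi => hp i hi b hb v,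
    Finset.sum_ite_eq]

theorem SpectralMatch.aeval_paritySum_apply (hm : SpectralMatch G G' B C B' C')
    (h : IsSemiregular G B C k ℓ) (h' : IsSemiregular G' B' C' k ℓ) (hG : G.Connected)
    (hG' : G'.Connected) {d e : ℕ} (hd : ∀ u v, G.dist u v ≤ d) (hed : e ≤ d) (hde : d ≤ e + 1)
    {p : ℕ → ℝ[X]} (hp : ∀ i ≤ d, IsDistPolynomial G B i (p i)) {b : V'} (hb : b ∈ B') (v : V') :
    aeval (G'.adjMatrix ℝ) (paritySum p e) v b =
      if (Even (G'.dist b v) ↔ Even e) then 1 else 0 := by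
  have := hm.aeval_apply_eq_indicator (p := paritySum p e) (decide (Even e)) (fun b hb v => by
    rw [paritySum, sum_aeval_apply_of_isDistPolynomial (fun i hi => hp i (by
      have := Finset.mem_range.mp (Finset.mem_filter.mp hi).1; omega)) hb v]
    refine if_congr ?_ rfl rfl
    rw [h.mem_cond_iff hG hb, Finset.mem_filter, Finset.mem_range, and_iff_right_iff_imp]
    intro hpar
    have := hd b v
    by_contra hlt
    obtain heq : G.dist b v = e + 1 := by omega
    rw [heq, Nat.even_add_one] at hpar
    tauto) b hb v
  rw [this]
  exact if_congr (h'.mem_cond_iff hG' hb v e) rfl rfl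

/-- Distance polynomials transfer to a graph which is spectrally indistinguishable from one of
large girth. -/
theorem SpectralMatch.isDistPolynomial (hm : SpectralMatch G G' B C B' C')
    (h : IsSemiregular G B C k ℓ) (h' : IsSemiregular G' B' C' k ℓ) (hG : G.Connected)
    (hG' : G'.Connected) {d : ℕ} (hd0 : d ≠ 0) (hd : ∀ u v, G.dist u v ≤ d)
    (hgirth : ((2 * d - 2 : ℕ) : ℕ∞) ≤ G.egirth) {p : ℕ → ℝ[X]}
    (hp : ∀ i ≤ d, IsDistPolynomial G B i (p i)) (hdeg : ∀ i ≤ d, (p i).natDegree ≤ i) :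
    (∀ i ≤ d, IsDistPolynomial G' B' i (p i)) ∧ ∀ b ∈ B', ∀ v, G'.dist b v ≤ d := by
  have hsum {e : ℕ} (hed : e ≤ d) (hde : d ≤ e + 1) {b : V'} (hb : b ∈ B') (v : V') :=
    hm.aeval_paritySum_apply h h' hG hG' hd hed hde hp hb v
  have hle {e : ℕ} (hed : e ≤ d) (hde : d ≤ e + 1) {b : V'} (hb : b ∈ B') {v : V'}
      (hpar : Even (G'.dist b v) ↔ Even e) : G'.dist b v ≤ e := by
    rw [SimpleGraph.dist_comm]
    refine (SimpleGraph.dist_le_natDegree (p := paritySum p e) ?_).trans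
      (natDegree_paritySum_le fun i hi => hdeg i (hi.trans hed))
    rw [hsum hed hde hb, if_pos hpar]
    exact one_ne_zero
  refine ⟨fun e hed => ?_, fun b hb v => ?_⟩
  · by_cases hde : e + 2 ≤ d
    · exact hm.isDistPolynomial_of_add_two_le h h' hG hG' hgirth hp hde
    intro b hb v
    have hv := hsum hed (by omega) hb v
    rw [paritySum_eq, map_add, Matrix.add_apply, sum_aeval_apply_of_isDistPolynomial (fun i hi => by
      obtain ⟨hlt, hpar⟩ := Finset.mem_filter.mp hi
      have hlt := Finset.mem_range.mp hlt
      refine hm.isDistPolynomial_of_add_two_le h h' hG hG' hgirth hp ?_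
      by_contra
      obtain rfl : e = i + 1 := by omega
      rw [Nat.even_add_one] at hpar
      tauto) hb v] at hv
    rw [eq_sub_of_add_eq hv]
    by_cases hpar : Even (G'.dist b v) ↔ Even e
    · have := hle hed (by omega) hb hpar
      rcases this.lt_or_eq with hlt | heq
      · simp [hpar, hlt, hlt.ne]
      · simp [heq]
    · have hne : G'.dist b v ≠ e := fun heq => hpar (by rw [heq])
      simp [hpar, hne]
  · by_cases hpar : Even (G'.dist b v) ↔ Even d
    · exact hle le_rfl (by omega) hb hpar
    · refine (hle (e := d - 1) (by omega) (by omega) hb ?_).trans (by omega)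
      obtain ⟨e, rfl⟩ := Nat.exists_eq_succ_of_ne_zero hd0
      rw [Nat.succ_eq_add_one, Nat.even_add_one] at hpar
      rw [Nat.succ_eq_add_one, Nat.add_sub_cancel]
      tauto

end Transfer

section Diameter

variable {V : Type*} [Fintype V] {G : SimpleGraph V} [DecidableRel G.Adj] {B C : Finset V}
  {k ℓ : ℕ}

theorem IsSemiregular.left_ne_zero [Nontrivial V] (h : IsSemiregular G B C k ℓ)
    (hG : G.Connected) : k ≠ 0 := by
  obtain ⟨u⟩ := hG.nonempty
  obtain ⟨w, huw⟩ := hG.preconnected.exists_adj_of_nontrivial u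
  rcases h.bipartition.2.2 u w huw with ⟨hu, -⟩ | ⟨-, hw⟩
  · rw [← h.degree_left u hu]
    exact (G.degree_pos_iff_exists_adj u |>.mpr ⟨w, huw⟩).ne'
  · rw [← h.degree_left w hw]
    exact (G.degree_pos_iff_exists_adj w |>.mpr ⟨u, huw.symm⟩).ne'

variable [DecidableEq V]

theorem IsSemiregular.aeval_X_mul_eq_zero (h : IsSemiregular G B C k ℓ) {p : ℝ[X]}
    (hp : ∀ b ∈ B, ∀ v, aeval (G.adjMatrix ℝ) p v b = 0) :
    aeval (G.adjMatrix ℝ) (X * p) = 0 := by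
  ext v c
  rw [Matrix.zero_apply]
  rcases h.bipartition.1 c with hc | hc
  · rw [map_mul, aeval_X, SimpleGraph.adjMatrix_mul_apply]
    exact Finset.sum_eq_zero fun w _ => hp c hc w
  · rw [mul_comm, map_mul, aeval_X, SimpleGraph.mul_adjMatrix_apply]
    refine Finset.sum_eq_zero fun w hw => hp w ?_ v
    rw [← not_not (a := w ∈ B), ← h.mem_left_iff_of_adj ((G.mem_neighborFinset c w).mp hw),
      ← h.mem_right_iff]
    exact hc

/-- Polynomials of the same degree `d` annihilating the columns indexed by the respective parts
force the adjacency matrix to have at most `d` eigenvalues. -/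
theorem IsSemiregular.ncard_spectrum_le (h : IsSemiregular G B C k ℓ) {d : ℕ} {p q : ℝ[X]}
    (hp : p.degree = d) (hq : q.degree = d)
    (hp0 : ∀ b ∈ B, ∀ v, aeval (G.adjMatrix ℝ) p v b = 0)
    (hq0 : ∀ c ∈ C, ∀ v, aeval (G.adjMatrix ℝ) q v c = 0) :
    (spectrum ℝ (G.adjMatrix ℝ)).ncard ≤ d := by
  have hpne : p ≠ 0 := ne_zero_of_degree_gt (n := ⊥) (by rw [hp]; exact WithBot.bot_lt_coe d)
  have hqne : q ≠ 0 := ne_zero_of_degree_gt (n := ⊥) (by rw [hq]; exact WithBot.bot_lt_coe d)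
  have hlp := leadingCoeff_ne_zero.mpr hpne
  have hlq := leadingCoeff_ne_zero.mpr hqne
  set r : ℝ[X] := Polynomial.C q.leadingCoeff * p - Polynomial.C p.leadingCoeff * q with hr
  have hr0 : aeval (G.adjMatrix ℝ) (X * r) = 0 := by
    rw [hr, mul_sub, mul_left_comm, mul_left_comm X, map_sub, map_mul,
      map_mul (aeval _) (Polynomial.C _) (X * q), h.aeval_X_mul_eq_zero hp0,
      h.symm.aeval_X_mul_eq_zero hq0, mul_zero, mul_zero, sub_zero]
  by_cases hrz : r = 0
  · have hpq : Polynomial.C q.leadingCoeff * p = Polynomial.C p.leadingCoeff * q :=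
      sub_eq_zero.mp hrz
    have : aeval (G.adjMatrix ℝ) p = 0 := by
      ext v c
      rcases h.bipartition.1 c with hc | hc
      · exact hp0 c hc v
      · have := congr_fun₂ (congr_arg (aeval (G.adjMatrix ℝ)) hpq) v c
        rw [map_mul, map_mul, aeval_C, aeval_C, ← Algebra.smul_def, ← Algebra.smul_def,
          Matrix.smul_apply, Matrix.smul_apply, hq0 c hc v, smul_zero] at this
        exact (smul_eq_zero.mp this).resolve_left hlq
    exact (ncard_spectrum_le_natDegree hpne this).trans (natDegree_eq_of_degree_eq_some hp).le
  · have hdeg : r.degree < d := by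
      rw [← hp, ← degree_C_mul hlq (p := p)]
      refine degree_sub_lt_left ?_ (mul_ne_zero (C_ne_zero.mpr hlq) hpne) ?_
      · rw [degree_C_mul hlq, degree_C_mul hlp, hp, hq]
      · rw [leadingCoeff_C_mul_of_isUnit hlq.isUnit, leadingCoeff_C_mul_of_isUnit hlp.isUnit,
          mul_comm]
    have := ncard_spectrum_le_natDegree (mul_ne_zero X_ne_zero hrz) hr0
    rw [natDegree_X_mul hrz] at this
    have := (natDegree_lt_iff_degree_lt hrz).mpr hdeg
    omega

theorem IsSemiregular.isDiam_of_isDistPolynomial (h : IsSemiregular G B C k ℓ) {d : ℕ}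
    {p q : ℝ[X]} (hp : p.degree = d) (hq : q.degree = d) (hpB : IsDistPolynomial G B d p)
    (hqC : IsDistPolynomial G C d q) (hle : ∀ u v, G.dist u v ≤ d)
    (hspec : d < (spectrum ℝ (G.adjMatrix ℝ)).ncard) : IsDiam G d := by
  refine ⟨hle, ?_⟩
  by_contra! hne
  exact hspec.not_ge (h.ncard_spectrum_le hp hq
    (fun b hb v => by rw [hpB b hb v, if_neg (hne b v)])
    fun c hc v => by rw [hqC c hc v, if_neg (hne c v)])

end Diameter

theorem spectrum_eq_of_charpoly_eq {V V' : Type*} [Fintype V] [DecidableEq V] [Fintype V']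
    [DecidableEq V'] {A : Matrix V V ℝ} {A' : Matrix V' V' ℝ} (h : A'.charpoly = A.charpoly) :
    spectrum ℝ A' = spectrum ℝ A := by
  ext x
  rw [Matrix.mem_spectrum_iff_isRoot_charpoly, h, ← Matrix.mem_spectrum_iff_isRoot_charpoly]

/-- A graph cospectral to a distance-biregular graph of diameter `d` and girth at least
`2d - 2`, with the same valencies, is distance-biregular. -/
theorem cospectral_to_distance_biregular_of_girth
    {V V' : Type*} [Fintype V] [DecidableEq V] [Fintype V'] [DecidableEq V']
    (G : SimpleGraph V) [DecidableRel G.Adj] (G' : SimpleGraph V') [DecidableRel G'.Adj]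
    (hconn : G.Connected) (B C : Finset V) (hbip : IsBipartition G B C)
    (d : ℕ) (hd : IsDiam G d) (hgirth : ((2 * d - 2 : ℕ) : ℕ∞) ≤ G.egirth)
    (k ℓ : ℕ) (hkB : ∀ b ∈ B, G.degree b = k) (hlC : ∀ c ∈ C, G.degree c = ℓ)
    (hdbr : IsDistBiregular G (G.adjMatrix ℝ) B C d)
    (hconn' : G'.Connected) (B' C' : Finset V') (hbip' : IsBipartition G' B' C')
    (hkB' : ∀ b ∈ B', G'.degree b = k) (hlC' : ∀ c ∈ C', G'.degree c = ℓ)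
    (hcospectral : (G'.adjMatrix ℝ).charpoly = (G.adjMatrix ℝ).charpoly) :
    ∃ d' : ℕ, IsDiam G' d' ∧ IsDistBiregular G' (G'.adjMatrix ℝ) B' C' d' := by
  obtain ⟨hspec, pB, pC, hpoly⟩ := hdbr
  have hspec' : (spectrum ℝ (G'.adjMatrix ℝ)).ncard = d + 1 := by
    rw [spectrum_eq_of_charpoly_eq hcospectral, hspec]
  have h : IsSemiregular G B C k ℓ := ⟨hbip, hkB, hlC⟩
  have h' : IsSemiregular G' B' C' k ℓ := ⟨hbip', hkB', hlC'⟩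
  obtain ⟨u, v, huv⟩ := hd.2
  rcases eq_or_ne d 0 with rfl | hd0
  · have : Subsingleton V := ⟨fun a b => hconn.dist_eq_zero_iff.mp (Nat.le_zero.mp (hd.1 a b))⟩
    have : Subsingleton V' := by
      rw [← Fintype.card_le_one_iff_subsingleton, ← (G'.adjMatrix ℝ).charpoly_natDegree_eq_dim,
        hcospectral, Matrix.charpoly_natDegree_eq_dim, Fintype.card_le_one_iff_subsingleton]
      infer_instance
    obtain ⟨w⟩ := hconn'.nonempty
    refine ⟨0, ⟨fun a b => ?_, w, w, SimpleGraph.dist_self⟩, hspec', 1, 1, fun i hi => ?_⟩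
    · rw [Subsingleton.elim a b, SimpleGraph.dist_self]
    · obtain rfl := Nat.le_zero.mp hi
      exact ⟨degree_one, degree_one,
        isDistPolynomial_iff.mp (isDistPolynomial_zero_one hconn'),
        isDistPolynomial_iff.mp (isDistPolynomial_zero_one hconn')⟩
  · have : Nontrivial V := ⟨u, v, fun heq => hd0 <| by rw [← huv, heq, SimpleGraph.dist_self]⟩
    have hm := h.spectralMatch h' (h.left_ne_zero hconn) hcospectral
    have hm' := h.symm.spectralMatch h'.symm (h.symm.left_ne_zero hconn) hcospectral
    obtain ⟨hB, hleB⟩ := hm.isDistPolynomial h h' hconn hconn' hd0 hd.1 hgirth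
      (fun i hi => isDistPolynomial_iff.mpr (hpoly i hi).2.2.1)
      fun i hi => natDegree_le_of_degree_le (hpoly i hi).1.le
    obtain ⟨hC, hleC⟩ := hm'.isDistPolynomial h.symm h'.symm hconn hconn' hd0 hd.1 hgirth
      (fun i hi => isDistPolynomial_iff.mpr (hpoly i hi).2.2.2)
      fun i hi => natDegree_le_of_degree_le (hpoly i hi).2.1.le
    refine ⟨d, ?_, hspec', pB, pC, fun i hi => ⟨(hpoly i hi).1, (hpoly i hi).2.1,
      isDistPolynomial_iff.mp (hB i hi), isDistPolynomial_iff.mp (hC i hi)⟩⟩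
    refine h'.isDiam_of_isDistPolynomial (hpoly d le_rfl).1 (hpoly d le_rfl).2.1 (hB d le_rfl)
      (hC d le_rfl) (fun a b => ?_) (by omega)
    exact (hbip'.1 a).elim (fun ha => hleB a ha b) fun ha => hleC a ha b
end

section
/- Let G be a finite simple connected graph with adjacency matrix A, largest eigenvalue λ, and Perron eigenvector v. Let u be a vertex of eccentricity e ≥ 1 with |Φ_u| = e+1. Then u is pseudo-distance-regular if and only if there exists a real polynomial p of degree at most e−1 with ‖p‖_u ≤ 1 and p(λ) = (1/v_u)·√(Σ_{w ∈ N_{e−1}(u)} v_w²). -/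
open Polynomial Matrix

/-- `u` has eccentricity `e` in `G`. -/
def IsEcc {V : Type*} (G : SimpleGraph V) (u : V) (e : ℕ) : Prop :=
  (∀ v, G.dist u v ≤ e) ∧ ∃ v, G.dist u v = e

/-- The eigenvalue support of the vertex `u`: those eigenvalues `θ` of `A` whose spectral
idempotent `E_θ` satisfies `E_θ e_u ≠ 0`, equivalently those `θ` admitting an eigenvector
not vanishing at `u`. -/
def eSupport {V : Type*} [Fintype V] (A : Matrix V V ℝ) (u : V) : Set ℝ :=
  {θ : ℝ | ∃ w : V → ℝ, A *ᵥ w = θ • w ∧ w u ≠ 0}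

/-- The vertex `u`, of eccentricity `e`, is pseudo-distance-regular. -/
def IsPseudoDistRegular {V : Type*} [Fintype V] [DecidableEq V] (G : SimpleGraph V)
    (A : Matrix V V ℝ) (u : V) (e : ℕ) : Prop :=
  (eSupport A u).ncard = e + 1 ∧
    ∀ i ≤ e, ∃ p : Polynomial ℝ, p.degree = (i : WithBot ℕ) ∧
      ∀ w, (aeval A p *ᵥ Pi.single u 1) w ≠ 0 ↔ G.dist u w = i

/-- The `u`-local inner product of polynomials: `⟨p, q⟩_u = e_uᵀ p(A) q(A) e_u`. -/
noncomputable def localIP {V : Type*} [Fintype V] [DecidableEq V] (A : Matrix V V ℝ)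
    (u : V) (p q : Polynomial ℝ) : ℝ :=
  (aeval A (p * q)) u u

/-- `lam` is the largest eigenvalue of `A` and `pv` is the Perron eigenvector: a unit-norm
`lam`-eigenvector with all entries positive. -/
def IsPerron {V : Type*} [Fintype V] (A : Matrix V V ℝ) (lam : ℝ) (pv : V → ℝ) : Prop :=
  A *ᵥ pv = lam • pv ∧ (∀ w, 0 < pv w) ∧ (∑ w, pv w ^ 2 = 1) ∧
    ∀ (θ : ℝ) (w : V → ℝ), w ≠ 0 → A *ᵥ w = θ • w → θ ≤ lam

section DotProduct

variable {V : Type*} [Fintype V]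

theorem dotProduct_mulVec_comm_of_isSymm {A : Matrix V V ℝ} (hA : A.IsSymm) (x y : V → ℝ) :
    x ⬝ᵥ (A *ᵥ y) = (A *ᵥ x) ⬝ᵥ y := by
  rw [dotProduct_mulVec, ← mulVec_transpose, hA.eq]

theorem exists_orthogonal_family (f : ℕ → V → ℝ) :
    ∃ g : ℕ → V → ℝ, (∀ i j, i ≠ j → g i ⬝ᵥ g j = 0) ∧
      ∀ n, Submodule.span ℝ (g '' Set.Iic n) = Submodule.span ℝ (f '' Set.Iic n) := by
  let F : ℕ → EuclideanSpace ℝ V := fun i => WithLp.toLp 2 (f i)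
  refine ⟨fun i => (InnerProductSpace.gramSchmidt ℝ F i).ofLp, fun i j hij => ?_, fun n => ?_⟩
  · have := InnerProductSpace.gramSchmidt_orthogonal ℝ F hij.symm
    rwa [EuclideanSpace.inner_eq_star_dotProduct, star_trivial] at this
  · have h := congrArg (Submodule.map (WithLp.linearEquiv 2 ℝ (V → ℝ)).toLinearMap)
      (InnerProductSpace.span_gramSchmidt_Iic ℝ F n)
    rw [Submodule.map_span, Submodule.map_span, ← Set.image_comp, ← Set.image_comp] at h
    exact h

theorem exists_coeff_of_mem_span {g : ℕ → V → ℝ} {n : ℕ} {z : V → ℝ}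
    (hg : ∀ i j, i ≠ j → g i ⬝ᵥ g j = 0)
    (hz : z ∈ Submodule.span ℝ (g '' Set.Iic n)) :
    ∃ c : ℕ → ℝ, z = ∑ i ∈ Finset.range (n + 1), c i • g i ∧
      ∀ i ≤ n, g i ⬝ᵥ z = c i * (g i ⬝ᵥ g i) := by
  have hset : Set.Iic n = ((Finset.range (n + 1) : Finset ℕ) : Set ℕ) := by
    ext i; simp
  rw [hset] at hz
  obtain ⟨c, hc⟩ := (Submodule.mem_span_image_finset_iff_exists_fun' ℝ).1 hz
  refine ⟨c, hc.symm, fun i hi => ?_⟩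
  rw [← hc, dotProduct_sum, Finset.sum_eq_single i]
  · simp
  · intro j _ hj; simp [hg i j hj.symm]
  · intro h; simp at h; omega

theorem dotProduct_eq_zero_of_mem_span {g : ℕ → V → ℝ} {n k : ℕ} {z : V → ℝ}
    (hg : ∀ i j, i ≠ j → g i ⬝ᵥ g j = 0)
    (hz : z ∈ Submodule.span ℝ (g '' Set.Iic n)) (hk : n < k) : z ⬝ᵥ g k = 0 := by
  obtain ⟨c, rfl, -⟩ := exists_coeff_of_mem_span hg hz
  rw [sum_dotProduct]
  refine Finset.sum_eq_zero fun i hi => ?_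
  rw [smul_dotProduct, hg i k (by have := Finset.mem_range.1 hi; omega), smul_zero]

/-- The restriction of `z` to the ball of radius `n` around `u`. -/
noncomputable def ballRestrict (G : SimpleGraph V) (u : V) (n : ℕ) (z : V → ℝ) : V → ℝ :=
  fun w => if G.dist u w ≤ n then z w else 0

theorem ballRestrict_dotProduct_self {G : SimpleGraph V} (u : V) (n : ℕ) (z : V → ℝ) :
    ballRestrict G u n z ⬝ᵥ ballRestrict G u n z =
      ∑ w ∈ Finset.univ.filter fun w => G.dist u w ≤ n, z w ^ 2 := by
  rw [Finset.sum_filter, dotProduct]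
  refine Finset.sum_congr rfl fun w _ => ?_
  unfold ballRestrict
  split_ifs <;> ring

theorem ballRestrict_dotProduct_self_pos {G : SimpleGraph V} {u : V} {n : ℕ} {z : V → ℝ}
    (hz : z u ≠ 0) :
    0 < ballRestrict G u n z ⬝ᵥ ballRestrict G u n z := by
  rw [ballRestrict_dotProduct_self]
  refine Finset.sum_pos' (fun _ _ => sq_nonneg _) ⟨u, by simp, by positivity⟩

end DotProduct

section PolynomialVector

variable {V : Type*} [Fintype V] [DecidableEq V]

/-- The linear map `p ↦ p(A) x`. -/
noncomputable def polyVec (A : Matrix V V ℝ) (x : V → ℝ) : ℝ[X] →ₗ[ℝ] (V → ℝ) where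
  toFun p := aeval A p *ᵥ x
  map_add' p q := by rw [map_add, Matrix.add_mulVec]
  map_smul' c p := by rw [map_smul, Matrix.smul_mulVec, RingHom.id_apply]

/-- The Krylov space of all `p(A) x` with `p` of degree at most `n`. -/
noncomputable def krylov (A : Matrix V V ℝ) (x : V → ℝ) (n : ℕ) : Submodule ℝ (V → ℝ) :=
  (degreeLE ℝ n).map (polyVec A x)

theorem polyVec_apply (A : Matrix V V ℝ) (x : V → ℝ) (p : ℝ[X]) :
    polyVec A x p = aeval A p *ᵥ x := rfl

theorem polyVec_mul (A : Matrix V V ℝ) (x : V → ℝ) (p q : ℝ[X]) :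
    polyVec A x (p * q) = aeval A p *ᵥ polyVec A x q := by
  simp [polyVec_apply]

theorem polyVec_X_pow (A : Matrix V V ℝ) (x : V → ℝ) (n : ℕ) :
    polyVec A x (X ^ n) = A ^ n *ᵥ x := by
  simp [polyVec_apply]

theorem mem_krylov {A : Matrix V V ℝ} {x z : V → ℝ} {n : ℕ} :
    z ∈ krylov A x n ↔ ∃ p : ℝ[X], p.degree ≤ (n : WithBot ℕ) ∧ polyVec A x p = z := by
  simp [krylov, Submodule.mem_map, mem_degreeLE]

theorem krylov_mono {A : Matrix V V ℝ} {x : V → ℝ} {m n : ℕ} (h : m ≤ n) :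
    krylov A x m ≤ krylov A x n :=
  Submodule.map_mono (degreeLE_mono (by exact_mod_cast h))

theorem krylov_eq_span (A : Matrix V V ℝ) (x : V → ℝ) (n : ℕ) :
    krylov A x n = Submodule.span ℝ ((fun i : ℕ => A ^ i *ᵥ x) '' Set.Iic n) := by
  classical
  rw [krylov, degreeLE_eq_span_X_pow, Submodule.map_span]
  congr 1
  ext z
  simp [polyVec_X_pow]

theorem mulVec_mem_krylov_succ {A : Matrix V V ℝ} {x z : V → ℝ} {n : ℕ}
    (hz : z ∈ krylov A x n) : A *ᵥ z ∈ krylov A x (n + 1) := by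
  obtain ⟨p, hp, rfl⟩ := mem_krylov.1 hz
  refine mem_krylov.2 ⟨X * p, ?_, by simp [polyVec_mul]⟩
  have h := degree_mul_le_of_le (degree_X_le (R := ℝ)) hp
  rwa [add_comm, ← Nat.cast_one, ← Nat.cast_add] at h

theorem isSymm_aeval {A : Matrix V V ℝ} (hA : A.IsSymm) (p : ℝ[X]) :
    (aeval A p).IsSymm := by
  induction p using Polynomial.induction_on' with
  | add p q hp hq => rw [map_add]; exact hp.add hq
  | monomial n a =>
    rw [aeval_monomial, ← Algebra.smul_def]
    exact (hA.pow n).smul a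

theorem aeval_mulVec_eigenvector {A : Matrix V V ℝ} {θ : ℝ} {w : V → ℝ}
    (hw : A *ᵥ w = θ • w) (p : ℝ[X]) : aeval A p *ᵥ w = p.eval θ • w := by
  have hpow : ∀ n : ℕ, A ^ n *ᵥ w = θ ^ n • w := by
    intro n
    induction n with
    | zero => simp
    | succ n ih => rw [pow_succ, ← mulVec_mulVec, hw, mulVec_smul, ih, smul_smul]; ring_nf
  induction p using Polynomial.induction_on' with
  | add p q hp hq => rw [map_add, add_mulVec, hp, hq, eval_add, add_smul]
  | monomial n a =>
    rw [aeval_monomial, ← Algebra.smul_def, smul_mulVec, hpow, eval_monomial, smul_smul]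

theorem polyVec_single_dotProduct_eigenvector {A : Matrix V V ℝ} (hA : A.IsSymm) {θ : ℝ}
    {w : V → ℝ} (hw : A *ᵥ w = θ • w) (u : V) (p : ℝ[X]) :
    polyVec A (Pi.single u 1) p ⬝ᵥ w = p.eval θ * w u := by
  rw [polyVec_apply, ← dotProduct_mulVec_comm_of_isSymm (isSymm_aeval hA p),
    aeval_mulVec_eigenvector hw]
  simp

theorem localIP_eq_dotProduct {A : Matrix V V ℝ} (hA : A.IsSymm) (u : V) (p q : ℝ[X]) :
    localIP A u p q = polyVec A (Pi.single u 1) p ⬝ᵥ polyVec A (Pi.single u 1) q := by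
  rw [polyVec_apply, ← dotProduct_mulVec_comm_of_isSymm (isSymm_aeval hA p), ← polyVec_mul,
    polyVec_apply, localIP]
  simp

theorem eq_zero_of_dotProduct_eigenvectors {A : Matrix V V ℝ} (hA : A.IsSymm) {z : V → ℝ}
    (hz : ∀ (θ : ℝ) (w : V → ℝ), A *ᵥ w = θ • w → z ⬝ᵥ w = 0) : z = 0 := by
  have hH : A.IsHermitian := by
    rw [Matrix.IsHermitian, conjTranspose_eq_transpose_of_trivial]; exact hA
  have h0 : WithLp.toLp 2 z = (0 : EuclideanSpace ℝ V) := by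
    rw [← hH.eigenvectorBasis.sum_repr (WithLp.toLp 2 z)]
    refine Finset.sum_eq_zero fun i _ => ?_
    have := hz _ _ (hH.mulVec_eigenvectorBasis i)
    rw [hH.eigenvectorBasis.repr_apply_apply, EuclideanSpace.inner_eq_star_dotProduct]
    simp [this]
  simpa using congrArg WithLp.ofLp h0

/-- If the eigenvalue support of `u` has `n + 1` elements, then every `p(A) e_u` is attained by a
polynomial of degree at most `n`. -/
theorem polyVec_single_mem_krylov {A : Matrix V V ℝ} (hA : A.IsSymm) {u : V} {n : ℕ}
    (hsupp : (eSupport A u).ncard = n + 1) (p : ℝ[X]) :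
    polyVec A (Pi.single u 1) p ∈ krylov A (Pi.single u 1) n := by
  have hfin : (eSupport A u).Finite := Set.finite_of_ncard_pos (by omega)
  set m : ℝ[X] := ∏ θ ∈ hfin.toFinset, (X - C θ) with hm
  have hmonic : m.Monic := monic_prod_X_sub_C _ _
  have hdeg : m.natDegree = n + 1 := by
    rw [hm, natDegree_finsetProd_X_sub_C_eq_card, ← hsupp, Set.ncard_eq_toFinset_card _ hfin]
  have hzero : polyVec A (Pi.single u 1) m = 0 := by
    refine eq_zero_of_dotProduct_eigenvectors hA fun θ w hw => ?_
    rw [polyVec_single_dotProduct_eigenvector hA hw]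
    by_cases hwu : w u = 0
    · rw [hwu, mul_zero]
    · have hθ : θ ∈ hfin.toFinset := hfin.mem_toFinset.2 ⟨w, hw, hwu⟩
      rw [hm, eval_prod, Finset.prod_eq_zero hθ (by simp), zero_mul]
  refine mem_krylov.2 ⟨p %ₘ m, ?_, ?_⟩
  · have h := natDegree_modByMonic_lt p hmonic fun h => by simp [h] at hdeg
    exact degree_le_of_natDegree_le (by omega)
  · conv_rhs => rw [← modByMonic_add_div p m]
    rw [map_add, mul_comm m, polyVec_mul, hzero, mulVec_zero, add_zero]

theorem mulVec_mem_krylov {A : Matrix V V ℝ} (hA : A.IsSymm) {u : V} {n : ℕ}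
    (hsupp : (eSupport A u).ncard = n + 1) {z : V → ℝ}
    (hz : z ∈ krylov A (Pi.single u 1) n) : A *ᵥ z ∈ krylov A (Pi.single u 1) n := by
  obtain ⟨p, -, rfl⟩ := mem_krylov.1 hz
  have := polyVec_single_mem_krylov hA hsupp (X * p)
  rwa [polyVec_mul, aeval_X] at this

/-- An orthogonal family spanning the Krylov spaces. -/
theorem exists_orthogonal_krylov (A : Matrix V V ℝ) (x : V → ℝ) :
    ∃ g : ℕ → V → ℝ, (∀ i j, i ≠ j → g i ⬝ᵥ g j = 0) ∧
      ∀ n, Submodule.span ℝ (g '' Set.Iic n) = krylov A x n := by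
  obtain ⟨g, h1, h2⟩ := exists_orthogonal_family fun i : ℕ => A ^ i *ᵥ x
  exact ⟨g, h1, fun n => by rw [h2, krylov_eq_span]⟩

end PolynomialVector

section Graph

/-- The eigenspace of the largest eigenvalue is spanned by the Perron eigenvector. -/
theorem eq_smul_of_isPerron {V : Type*} [Fintype V] {G : SimpleGraph V} [DecidableRel G.Adj]
    (hconn : G.Connected) {lam : ℝ} {pv : V → ℝ}
    (hperron : IsPerron (G.adjMatrix ℝ) lam pv) {w : V → ℝ}
    (hw : G.adjMatrix ℝ *ᵥ w = lam • w) : ∃ c : ℝ, w = c • pv := by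
  obtain ⟨hpv, hpos, -, -⟩ := hperron
  have := hconn.nonempty
  obtain ⟨a, ha⟩ := Finite.exists_min fun v => w v / pv v
  refine ⟨w a / pv a, ?_⟩
  set c := w a / pv a with hc
  have hy : G.adjMatrix ℝ *ᵥ (w - c • pv) = lam • (w - c • pv) := by
    rw [mulVec_sub, mulVec_smul, hw, hpv, smul_sub, smul_comm]
  have hnn : ∀ v, 0 ≤ (w - c • pv) v := fun v => by
    have := (le_div_iff₀ (hpos v)).1 (ha v)
    simpa using this
  have hstep : ∀ v v', G.Adj v v' → (w - c • pv) v = 0 → (w - c • pv) v' = 0 := by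
    intro v v' hadj hv
    have h := congrFun hy v
    rw [SimpleGraph.adjMatrix_mulVec_apply, Pi.smul_apply, hv, smul_zero,
      Finset.sum_eq_zero_iff_of_nonneg fun i _ => hnn i] at h
    exact h v' (by simpa using hadj)
  have ha0 : (w - c • pv) a = 0 := by
    simp [hc, div_mul_cancel₀ _ (hpos a).ne']
  have hall : ∀ v, (w - c • pv) v = 0 := by
    intro v
    have hwalk : ∀ {x y : V}, G.Walk x y → (w - c • pv) x = 0 → (w - c • pv) y = 0 := by
      intro x y p
      induction p with
      | nil => exact id
      | cons h p ih => exact fun hx => ih (hstep _ _ h hx)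
    obtain ⟨p⟩ := hconn.preconnected a v
    exact hwalk p ha0
  exact sub_eq_zero.1 (funext hall)

theorem exists_dist_eq_of_le_dist {V : Type*} {G : SimpleGraph V} (hconn : G.Connected)
    {u v : V} {i : ℕ} (hi : i ≤ G.dist u v) :
    ∃ w, G.dist u w = i := by
  obtain ⟨p, hp⟩ := hconn.exists_walk_length_eq_dist u v
  refine ⟨p.getVert i, ?_⟩
  have h1 : G.dist u (p.getVert i) ≤ i := by
    have := SimpleGraph.dist_le (p.take i)
    rw [SimpleGraph.Walk.take_length] at this
    omega
  have h2 : G.dist (p.getVert i) v ≤ p.length - i := by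
    have := SimpleGraph.dist_le (p.drop i)
    rwa [SimpleGraph.Walk.drop_length] at this
  have h3 := hconn.dist_triangle (u := u) (v := p.getVert i) (w := v)
  omega

variable {V : Type*} [Fintype V] [DecidableEq V] {G : SimpleGraph V} [DecidableRel G.Adj]

theorem adjMatrix_pow_mulVec_single (u w : V) (n : ℕ) :
    (G.adjMatrix ℝ ^ n *ᵥ Pi.single u 1) w = (G.adjMatrix ℝ ^ n) w u := by
  simp

theorem adjMatrix_pow_mulVec_single_eq_zero {u w : V} {n : ℕ} (h : n < G.dist u w) :
    (G.adjMatrix ℝ ^ n *ᵥ Pi.single u 1) w = 0 := by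
  rw [adjMatrix_pow_mulVec_single, SimpleGraph.adjMatrix_pow_apply_eq_card_walk]
  rw [Nat.cast_eq_zero, Fintype.card_eq_zero_iff]
  refine ⟨fun p => ?_⟩
  have h1 := SimpleGraph.dist_le p.1
  have h2 : p.1.length = n := p.2
  rw [SimpleGraph.dist_comm] at h1
  omega

theorem adjMatrix_pow_dist_mulVec_single_ne_zero (hconn : G.Connected) (u w : V) :
    (G.adjMatrix ℝ ^ G.dist u w *ᵥ Pi.single u 1) w ≠ 0 := by
  rw [adjMatrix_pow_mulVec_single, SimpleGraph.adjMatrix_pow_apply_eq_card_walk]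
  rw [Nat.cast_ne_zero, ← Nat.pos_iff_ne_zero, Fintype.card_pos_iff]
  obtain ⟨p, hp⟩ := hconn.exists_walk_length_eq_dist w u
  exact ⟨⟨p, hp.trans SimpleGraph.dist_comm⟩⟩

theorem eq_zero_of_mem_krylov {u w : V} {n : ℕ} {z : V → ℝ}
    (hz : z ∈ krylov (G.adjMatrix ℝ) (Pi.single u 1) n) (h : n < G.dist u w) : z w = 0 := by
  rw [krylov_eq_span] at hz
  induction hz using Submodule.span_induction with
  | mem z hz =>
    obtain ⟨i, hi, rfl⟩ := hz
    exact adjMatrix_pow_mulVec_single_eq_zero (lt_of_le_of_lt hi h)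
  | zero => rfl
  | add y z _ _ hy hz => rw [Pi.add_apply, hy, hz, add_zero]
  | smul a z _ hz => rw [Pi.smul_apply, hz, smul_zero]

theorem perron_mem_krylov (hconn : G.Connected) {lam : ℝ} {pv : V → ℝ}
    (hperron : IsPerron (G.adjMatrix ℝ) lam pv) {u : V} {n : ℕ}
    (hsupp : (eSupport (G.adjMatrix ℝ) u).ncard = n + 1) :
    pv ∈ krylov (G.adjMatrix ℝ) (Pi.single u 1) n := by
  have hA : (G.adjMatrix ℝ).IsSymm := G.isSymm_adjMatrix
  obtain ⟨hpv, hpos, hnorm, -⟩ := id hperron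
  have hfin : (eSupport (G.adjMatrix ℝ) u).Finite := Set.finite_of_ncard_pos (by omega)
  set q : ℝ[X] := ∏ θ ∈ hfin.toFinset.erase lam, (X - C θ) with hq
  have hq0 : q.eval lam ≠ 0 := by
    rw [hq, eval_prod, Finset.prod_ne_zero_iff]
    intro θ hθ
    simpa [sub_eq_zero] using (Finset.ne_of_mem_erase hθ).symm
  have hnorm' : pv ⬝ᵥ pv = 1 := by
    rw [← hnorm, dotProduct]; exact Finset.sum_congr rfl fun _ _ => (sq _).symm
  have key : polyVec (G.adjMatrix ℝ) (Pi.single u 1) q - (q.eval lam * pv u) • pv = 0 := by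
    refine eq_zero_of_dotProduct_eigenvectors hA fun θ w hw => ?_
    rw [sub_dotProduct, smul_dotProduct, polyVec_single_dotProduct_eigenvector hA hw]
    by_cases hθ : θ = lam
    · subst hθ
      obtain ⟨c, rfl⟩ := eq_smul_of_isPerron hconn hperron hw
      rw [dotProduct_smul, hnorm']
      simp only [Pi.smul_apply, smul_eq_mul]
      ring
    · have h1 : pv ⬝ᵥ w = 0 := by
        have h := dotProduct_mulVec_comm_of_isSymm hA pv w
        rw [hw, hpv, dotProduct_smul, smul_dotProduct, smul_eq_mul, smul_eq_mul] at h
        have : (θ - lam) * (pv ⬝ᵥ w) = 0 := by linarith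
        exact (mul_eq_zero.1 this).resolve_left (sub_ne_zero.2 hθ)
      have h2 : q.eval θ * w u = 0 := by
        by_cases hwu : w u = 0
        · rw [hwu, mul_zero]
        · have hmem : θ ∈ hfin.toFinset.erase lam :=
            Finset.mem_erase.2 ⟨hθ, hfin.mem_toFinset.2 ⟨w, hw, hwu⟩⟩
          rw [hq, eval_prod, Finset.prod_eq_zero hmem (by simp), zero_mul]
      rw [h1, h2]; simp
  have hc : q.eval lam * pv u ≠ 0 := mul_ne_zero hq0 (hpos u).ne'
  have := polyVec_single_mem_krylov hA hsupp q
  rw [sub_eq_zero.1 key] at this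
  exact (Submodule.smul_mem_iff _ hc).1 this

theorem dotProduct_ballRestrict {u : V} {n : ℕ} {y : V → ℝ}
    (hy : y ∈ krylov (G.adjMatrix ℝ) (Pi.single u 1) n) (z : V → ℝ) :
    y ⬝ᵥ ballRestrict G u n z = y ⬝ᵥ z := by
  rw [dotProduct, dotProduct]
  refine Finset.sum_congr rfl fun w _ => ?_
  unfold ballRestrict
  split_ifs with h
  · rfl
  · rw [eq_zero_of_mem_krylov hy (not_le.1 h)]; ring

theorem orthogonal_krylov_apply_ne_zero (hconn : G.Connected) {u w : V} {k : ℕ} {g : ℕ → V → ℝ}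
    (horth : ∀ i j, i ≠ j → g i ⬝ᵥ g j = 0)
    (hspan : ∀ n, Submodule.span ℝ (g '' Set.Iic n) = krylov (G.adjMatrix ℝ) (Pi.single u 1) n)
    (hw : G.dist u w = k) : g k w ≠ 0 := by
  intro h0
  have hmem : G.adjMatrix ℝ ^ k *ᵥ Pi.single u 1 ∈ Submodule.span ℝ (g '' Set.Iic k) := by
    rw [hspan, krylov_eq_span]
    exact Submodule.subset_span ⟨k, Set.self_mem_Iic, rfl⟩
  obtain ⟨c, hc, -⟩ := exists_coeff_of_mem_span horth hmem
  refine adjMatrix_pow_dist_mulVec_single_ne_zero hconn u w ?_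
  rw [hw, hc, Finset.sum_apply]
  refine Finset.sum_eq_zero fun i hi => ?_
  rw [Pi.smul_apply]
  rcases (Nat.lt_succ_iff.1 (Finset.mem_range.1 hi)).lt_or_eq with hik | rfl
  · have hgi : g i ∈ krylov (G.adjMatrix ℝ) (Pi.single u 1) i := by
      rw [← hspan]; exact Submodule.subset_span ⟨i, Set.self_mem_Iic, rfl⟩
    rw [eq_zero_of_mem_krylov hgi (hw ▸ hik), smul_zero]
  · rw [h0, smul_zero]

/-- If the top vector of an orthogonal Krylov family vanishes off the sphere of radius `e`, then
every member of the family vanishes off the corresponding sphere. -/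
theorem orthogonal_krylov_vanish (hconn : G.Connected) {u : V} {e : ℕ} (hecc : IsEcc G u e)
    (hsupp : (eSupport (G.adjMatrix ℝ) u).ncard = e + 1) {g : ℕ → V → ℝ}
    (horth : ∀ i j, i ≠ j → g i ⬝ᵥ g j = 0)
    (hspan : ∀ n, Submodule.span ℝ (g '' Set.Iic n) = krylov (G.adjMatrix ℝ) (Pi.single u 1) n)
    (htop : ∀ w, G.dist u w ≠ e → g e w = 0) {i : ℕ} (hi : i ≤ e) {w : V}
    (hw : G.dist u w ≠ i) : g i w = 0 := by
  have hA : (G.adjMatrix ℝ).IsSymm := G.isSymm_adjMatrix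
  set A := G.adjMatrix ℝ
  have hgmem : ∀ j, g j ∈ krylov A (Pi.single u 1) j := fun j => by
    rw [← hspan]; exact Submodule.subset_span ⟨j, Set.self_mem_Iic, rfl⟩
  induction hk : e - i using Nat.strong_induction_on generalizing i w with
  | _ k ih =>
  rcases hi.eq_or_lt with rfl | hie
  · exact htop w hw
  rcases lt_or_gt_of_ne hw with hlt | hgt
  swap
  · exact eq_zero_of_mem_krylov (hgmem i) hgt
  have hz : A *ᵥ g (i + 1) ∈ Submodule.span ℝ (g '' Set.Iic e) := by
    rw [hspan]
    exact mulVec_mem_krylov hA hsupp (krylov_mono hie (hgmem _))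
  obtain ⟨c, hc, hcoef⟩ := exists_coeff_of_mem_span horth hz
  have hlow : ∀ j < i, (A *ᵥ g j) ⬝ᵥ g (i + 1) = 0 := fun j hj => by
    refine dotProduct_eq_zero_of_mem_span horth (n := i) ?_ (Nat.lt_succ_self i)
    rw [hspan]
    exact krylov_mono hj (mulVec_mem_krylov_succ (hgmem j))
  have hci : c i ≠ 0 := by
    intro h0
    have hi0 : (A *ᵥ g i) ⬝ᵥ g (i + 1) = 0 := by
      rw [← dotProduct_mulVec_comm_of_isSymm hA, hcoef i hi, h0, zero_mul]
    have hall : ∀ y ∈ krylov A (Pi.single u 1) (i + 1), y ⬝ᵥ g (i + 1) = 0 := by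
      intro y hy
      obtain ⟨p, hp, rfl⟩ := mem_krylov.1 hy
      have h1 : polyVec A (Pi.single u 1) p.divX ∈ Submodule.span ℝ (g '' Set.Iic i) := by
        rw [hspan]
        refine mem_krylov.2 ⟨_, degree_le_of_natDegree_le ?_, rfl⟩
        have := natDegree_le_of_degree_le hp
        rw [natDegree_divX_eq_natDegree_tsub_one]
        omega
      have h2 : polyVec A (Pi.single u 1) (C (p.coeff 0)) ∈ Submodule.span ℝ (g '' Set.Iic i) := by
        rw [hspan]
        exact mem_krylov.2 ⟨_, degree_C_le.trans (by exact_mod_cast i.zero_le), rfl⟩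
      obtain ⟨a, ha, -⟩ := exists_coeff_of_mem_span horth h1
      rw [← X_mul_divX_add p, map_add, polyVec_mul, aeval_X, add_dotProduct,
        dotProduct_eq_zero_of_mem_span horth h2 (Nat.lt_succ_self i), add_zero,
        ← dotProduct_mulVec_comm_of_isSymm hA, ha, sum_dotProduct]
      refine Finset.sum_eq_zero fun j hj => ?_
      rw [smul_dotProduct, dotProduct_mulVec_comm_of_isSymm hA]
      rcases (Nat.lt_succ_iff.1 (Finset.mem_range.1 hj)).lt_or_eq with hj | rfl
      · rw [hlow j hj, smul_zero]
      · rw [hi0, smul_zero]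
    obtain ⟨v, hv⟩ := hecc.2
    obtain ⟨w', hw'⟩ := exists_dist_eq_of_le_dist hconn (hie.trans_eq hv.symm : i + 1 ≤ G.dist u v)
    have h0 := dotProduct_self_eq_zero.1 (hall _ (hgmem (i + 1)))
    exact orthogonal_krylov_apply_ne_zero hconn horth hspan hw' (congrFun h0 w')
  have hzw : (A *ᵥ g (i + 1)) w = 0 := by
    rw [SimpleGraph.adjMatrix_mulVec_apply]
    refine Finset.sum_eq_zero fun w' hw' => ?_
    refine ih (e - (i + 1)) (by omega) hie ?_ rfl
    have hadj : G.Adj w w' := by simpa using hw'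
    have h1 := hconn.dist_triangle (u := u) (v := w) (w := w')
    rw [SimpleGraph.dist_eq_one_iff_adj.2 hadj] at h1
    omega
  rw [hc, Finset.sum_apply, Finset.sum_eq_single i] at hzw
  · exact (mul_eq_zero.1 hzw).resolve_left hci
  · intro j hj hji
    have hje := Nat.lt_succ_iff.1 (Finset.mem_range.1 hj)
    rcases lt_or_gt_of_ne hji with hj' | hj'
    · have h := hcoef j hje
      rw [dotProduct_mulVec_comm_of_isSymm hA, hlow j hj'] at h
      rcases mul_eq_zero.1 h.symm with h | h
      · simp [h]
      · simp [dotProduct_self_eq_zero.1 h]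
    · rw [Pi.smul_apply, ih (e - j) (by omega) hje (by omega) rfl, smul_zero]
  · intro h
    exact absurd (Finset.mem_range.2 (by omega)) h

end Graph

/-- A spectrally extremal vertex `u` is pseudo-distance-regular iff the `(e-1)`-local
adjacency bound is attained at `u`. -/
theorem pseudo_distance_regular_iff_excess_bound_tight
    {V : Type*} [Fintype V] [DecidableEq V] (G : SimpleGraph V) [DecidableRel G.Adj]
    (hconn : G.Connected) (lam : ℝ) (pv : V → ℝ) (hperron : IsPerron (G.adjMatrix ℝ) lam pv)
    (u : V) (e : ℕ) (he : 1 ≤ e) (hecc : IsEcc G u e)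
    (hsupp : (eSupport (G.adjMatrix ℝ) u).ncard = e + 1) :
    IsPseudoDistRegular G (G.adjMatrix ℝ) u e ↔
      ∃ p : Polynomial ℝ, p.degree ≤ ((e - 1 : ℕ) : WithBot ℕ) ∧
        Real.sqrt (localIP (G.adjMatrix ℝ) u p p) ≤ 1 ∧
        p.eval lam = (1 / pv u) *
          Real.sqrt (∑ w ∈ Finset.univ.filter fun w => G.dist u w ≤ e - 1, pv w ^ 2) := by
  have hA : (G.adjMatrix ℝ).IsSymm := G.isSymm_adjMatrix
  obtain ⟨hpv, hpos, -, -⟩ := id hperron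
  have hpvmem := perron_mem_krylov hconn hperron hsupp
  obtain ⟨n, rfl⟩ : ∃ n, e = n + 1 := ⟨e - 1, by omega⟩
  rw [Nat.add_sub_cancel, ← ballRestrict_dotProduct_self]
  set A := G.adjMatrix ℝ
  set b := ballRestrict G u n pv with hb
  have hbpos : 0 < b ⬝ᵥ b := ballRestrict_dotProduct_self_pos (hpos u).ne'
  set s := √(b ⬝ᵥ b) with hs
  have hspos : 0 < s := Real.sqrt_pos.2 hbpos
  have hss : s * s = b ⬝ᵥ b := Real.mul_self_sqrt hbpos.le
  constructor
  · rintro ⟨-, hp⟩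
    obtain ⟨q, hqdeg, hq⟩ := hp (n + 1) le_rfl
    obtain ⟨f, hfdeg, hf⟩ := mem_krylov.1 hpvmem
    have hqnat : q.natDegree = n + 1 := natDegree_eq_of_degree_eq_some hqdeg
    have hqlead : q.coeff (n + 1) ≠ 0 := by
      rw [← hqnat]
      exact leadingCoeff_ne_zero.2 fun h => by simp [h] at hqnat
    set a := f.coeff (n + 1) / q.coeff (n + 1) with ha
    have hrdeg : (f - C a * q).degree ≤ (n : WithBot ℕ) := by
      refine (degree_le_iff_coeff_zero _ _).2 fun m hm => ?_
      have hm' : n < m := by exact_mod_cast hm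
      rcases (Nat.succ_le_of_lt hm').eq_or_lt with rfl | hm''
      · simp [ha, div_mul_cancel₀ _ hqlead]
      · have h1 : f.coeff m = 0 :=
          coeff_eq_zero_of_natDegree_lt ((natDegree_le_of_degree_le hfdeg).trans_lt hm'')
        have h2 : q.coeff m = 0 := coeff_eq_zero_of_natDegree_lt (hqnat.trans_lt hm'')
        simp [h1, h2]
    have hrmem : polyVec A (Pi.single u 1) (f - C a * q) ∈ krylov A (Pi.single u 1) n :=
      mem_krylov.2 ⟨_, hrdeg, rfl⟩
    have hr : polyVec A (Pi.single u 1) (f - C a * q) = b := by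
      funext w
      by_cases hw : G.dist u w ≤ n
      · have hq0 : polyVec A (Pi.single u 1) q w = 0 := by
          by_contra h
          have := (hq w).1 h
          omega
        rw [C_mul', map_sub, map_smul, hf, Pi.sub_apply, Pi.smul_apply, hq0, smul_zero, sub_zero,
          hb, ballRestrict, if_pos hw]
      · rw [eq_zero_of_mem_krylov hrmem (not_le.1 hw), hb, ballRestrict, if_neg hw]
    have heval := polyVec_single_dotProduct_eigenvector hA hpv u (f - C a * q)
    rw [← dotProduct_ballRestrict hrmem, hr, ← hb, ← hss] at heval
    refine ⟨s⁻¹ • (f - C a * q), (degree_smul_le _ _).trans hrdeg, ?_, ?_⟩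
    · rw [localIP_eq_dotProduct hA, map_smul, hr, smul_dotProduct, dotProduct_smul, ← hss]
      refine Real.sqrt_le_iff.2 ⟨zero_le_one, le_of_eq ?_⟩
      simp only [smul_eq_mul]
      field_simp
    · rw [eval_smul, smul_eq_mul]
      have := (hpos u).ne'
      field_simp
      linarith
  · rintro ⟨q, hqdeg, hqnorm, hqeval⟩
    set y := polyVec A (Pi.single u 1) q with hy
    have hymem : y ∈ krylov A (Pi.single u 1) n := mem_krylov.2 ⟨q, hqdeg, rfl⟩
    have hyy : y ⬝ᵥ y ≤ 1 := by
      rw [localIP_eq_dotProduct hA] at hqnorm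
      simpa using (Real.sqrt_le_iff.1 hqnorm).2
    have hyb : y ⬝ᵥ b = s := by
      rw [dotProduct_ballRestrict hymem, polyVec_single_dotProduct_eigenvector hA hpv, hqeval]
      have := (hpos u).ne'
      field_simp
    have hsy : s • y = b := by
      have h1 : (s • y - b) ⬝ᵥ (s • y - b) = s * s * (y ⬝ᵥ y) - s * s := by
        simp only [sub_dotProduct, dotProduct_sub, smul_dotProduct, dotProduct_smul, smul_eq_mul,
          dotProduct_comm b y, hyb, ← hss]
        ring
      have h2 : 0 ≤ (s • y - b) ⬝ᵥ (s • y - b) :=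
        Finset.sum_nonneg fun _ _ => mul_self_nonneg _
      have h3 : (s • y - b) ⬝ᵥ (s • y - b) = 0 := by
        refine le_antisymm ?_ h2
        rw [h1]
        nlinarith [mul_pos hspos hspos]
      exact sub_eq_zero.1 (dotProduct_self_eq_zero.1 h3)
    obtain ⟨g, horth, hspan⟩ := exists_orthogonal_krylov A (Pi.single u 1)
    have hgmem : ∀ j, g j ∈ krylov A (Pi.single u 1) j := fun j => by
      rw [← hspan]; exact Submodule.subset_span ⟨j, Set.self_mem_Iic, rfl⟩
    have hzmem : pv - b ∈ Submodule.span ℝ (g '' Set.Iic (n + 1)) := by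
      rw [hspan, ← hsy]
      exact sub_mem hpvmem (Submodule.smul_mem _ _ (krylov_mono n.le_succ hymem))
    obtain ⟨c, hc, hcoef⟩ := exists_coeff_of_mem_span horth hzmem
    have hz : pv - b = c (n + 1) • g (n + 1) := by
      rw [hc, Finset.sum_range_succ, Finset.sum_eq_zero, zero_add]
      intro i hi
      have hin := Finset.mem_range.1 hi
      have h := hcoef i hin.le
      rw [dotProduct_sub, dotProduct_ballRestrict (krylov_mono (Nat.lt_succ_iff.1 hin) (hgmem i)),
        sub_self] at h
      rcases mul_eq_zero.1 h.symm with h | h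
      · rw [h, zero_smul]
      · rw [dotProduct_self_eq_zero.1 h, smul_zero]
    have hcne : c (n + 1) ≠ 0 := by
      intro h0
      obtain ⟨w, hw⟩ := hecc.2
      have h := congrFun hz w
      rw [h0, zero_smul, Pi.sub_apply, hb, ballRestrict, if_neg (by omega)] at h
      exact (hpos w).ne' (by simpa using h)
    have htop : ∀ w, G.dist u w ≠ n + 1 → g (n + 1) w = 0 := by
      intro w hw
      have hle := hecc.1 w
      have h := congrFun hz w
      rw [Pi.sub_apply, hb, ballRestrict, if_pos (by omega), sub_self] at h
      exact (mul_eq_zero.1 h.symm).resolve_left hcne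
    refine ⟨hsupp, fun i hi => ?_⟩
    obtain ⟨p, hpdeg, hp⟩ := mem_krylov.1 (hgmem i)
    have hpw : ∀ w, (aeval A p *ᵥ Pi.single u 1) w ≠ 0 ↔ G.dist u w = i := by
      intro w
      rw [← polyVec_apply, hp]
      refine ⟨fun h => ?_, orthogonal_krylov_apply_ne_zero hconn horth hspan⟩
      by_contra hw
      exact h (orthogonal_krylov_vanish hconn hecc hsupp horth hspan htop hi hw)
    refine ⟨p, hpdeg.eq_of_not_lt fun hlt => ?_, hpw⟩
    obtain ⟨v, hv⟩ := hecc.2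
    obtain ⟨w, hw⟩ := exists_dist_eq_of_le_dist hconn (hi.trans_eq hv.symm)
    refine (hpw w).2 hw ?_
    cases i with
    | zero => simp [degree_eq_bot.1 (Nat.WithBot.lt_zero_iff.1 hlt)]
    | succ i =>
      refine eq_zero_of_mem_krylov (mem_krylov.2 ⟨p, ?_, rfl⟩) (i.lt_succ_self.trans_eq hw.symm)
      refine (degree_le_iff_coeff_zero _ _).2 fun m hm => ?_
      exact (degree_lt_iff_coeff_zero _ _).1 hlt m (by exact_mod_cast hm)
end

section
/- Let G be a finite simple connected graph with adjacency matrix A, largest eigenvalue λ, and Perron eigenvector v. Let u be a vertex of eccentricity e and let 0 ≤ k ≤ e. Then every real polynomial p of degree at most k with ‖p‖_u ≤ 1 satisfies p(λ) ≤ (1/v_u)·√(Σ_{w ∈ N_k(u)} v_w²). -/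
open Polynomial Matrix

/-- Entries of a polynomial in the adjacency matrix vanish beyond the degree. -/
theorem aeval_adjMatrix_apply_eq_zero {V R : Type*} [Fintype V] [DecidableEq V] [CommRing R]
    {G : SimpleGraph V} [DecidableRel G.Adj] {p : R[X]} {u w : V}
    (h : p.natDegree < G.dist u w) : aeval (G.adjMatrix R) p u w = 0 := by
  rw [aeval_eq_sum_range, Matrix.sum_apply]
  refine Finset.sum_eq_zero fun i hi => ?_
  rw [Matrix.smul_apply, SimpleGraph.adjMatrix_pow_apply_eq_card_walk,
    Fintype.card_eq_zero_iff.2, Nat.cast_zero, smul_zero]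
  refine ⟨fun ⟨q, hq⟩ => ?_⟩
  have hle := G.dist_le q
  have hlen : q.length = i := hq
  have hi' := Finset.mem_range.1 hi
  omega

/-- A polynomial in a symmetric matrix is symmetric. -/
theorem Matrix.IsSymm.aeval {n R : Type*} [Fintype n] [DecidableEq n] [CommRing R]
    {A : Matrix n n R} (hA : A.IsSymm) (p : R[X]) : (aeval A p).IsSymm := by
  rw [Matrix.IsSymm, aeval_eq_sum_range, Matrix.transpose_sum]
  simp only [Matrix.transpose_smul, Matrix.transpose_pow, hA.eq]

/-- A polynomial in a matrix acts on an eigenvector by evaluation at the eigenvalue. -/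
theorem Matrix.aeval_mulVec_of_mulVec_eq_smul {n R : Type*} [Fintype n] [DecidableEq n]
    [CommRing R] {A : Matrix n n R} {c : R} {x : n → R} (h : A *ᵥ x = c • x) (p : R[X]) :
    aeval A p *ᵥ x = p.eval c • x := by
  have hpow (i : ℕ) : (A ^ i) *ᵥ x = c ^ i • x := by
    induction i with
    | zero => simp
    | succ i ih =>
      rw [pow_succ, ← Matrix.mulVec_mulVec, h, Matrix.mulVec_smul, ih, smul_smul, pow_succ']
  simp only [aeval_eq_sum_range, eval_eq_sum_range, Matrix.sum_mulVec, Matrix.smul_mulVec, hpow,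
    smul_smul, Finset.sum_smul]

/-- For a symmetric matrix, the local norm is the norm of a row of the polynomial in it. -/
theorem localIP_self_eq_sum_sq {V : Type*} [Fintype V] [DecidableEq V] {A : Matrix V V ℝ}
    (hA : A.IsSymm) (u : V) (p : ℝ[X]) : localIP A u p p = ∑ w, aeval A p u w ^ 2 := by
  rw [localIP, map_mul, Matrix.mul_apply]
  exact Finset.sum_congr rfl fun w _ => by rw [(hA.aeval p).apply u w, sq]

/-- The local adjacency polynomial bound: any polynomial `p` of degree at most `k` with
`‖p‖_u ≤ 1` satisfies `p(λ) ≤ (1 / v_u) √(∑_{w ∈ N_k(u)} v_w²)`. -/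
theorem local_adjacency_polynomial_bound
    {V : Type*} [Fintype V] [DecidableEq V] (G : SimpleGraph V) [DecidableRel G.Adj]
    (hconn : G.Connected) (lam : ℝ) (pv : V → ℝ) (hperron : IsPerron (G.adjMatrix ℝ) lam pv)
    (u : V) (e k : ℕ) (hecc : IsEcc G u e) (hk : k ≤ e)
    (p : Polynomial ℝ) (hdeg : p.degree ≤ (k : WithBot ℕ))
    (hnorm : Real.sqrt (localIP (G.adjMatrix ℝ) u p p) ≤ 1) :
    p.eval lam ≤ (1 / pv u) *
      Real.sqrt (∑ w ∈ Finset.univ.filter fun w => G.dist u w ≤ k, pv w ^ 2) := by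
  obtain ⟨heig, hpos, -, -⟩ := hperron
  set A := G.adjMatrix ℝ
  set s := Finset.univ.filter fun w => G.dist u w ≤ k
  have hrow : ∑ w ∈ s, aeval A p u w ^ 2 ≤ 1 := by
    refine (Finset.sum_le_univ_sum_of_nonneg fun w => sq_nonneg _).trans ?_
    rw [← localIP_self_eq_sum_sq (G.isSymm_adjMatrix) u p]
    exact Real.sqrt_le_one.1 hnorm
  have heval : p.eval lam * pv u = ∑ w ∈ s, aeval A p u w * pv w := by
    have h := congrFun (Matrix.aeval_mulVec_of_mulVec_eq_smul heig p) u
    rw [Pi.smul_apply, smul_eq_mul] at h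
    rw [← h]
    refine (Finset.sum_subset (Finset.subset_univ s) fun w _ hw => ?_).symm
    have hw' : k < G.dist u w := by simpa [s] using hw
    exact mul_eq_zero_of_left
      (aeval_adjMatrix_apply_eq_zero ((natDegree_le_of_degree_le hdeg).trans_lt hw')) _
  rw [one_div_mul_eq_div, le_div_iff₀ (hpos u), heval]
  refine (Real.sum_mul_le_sqrt_mul_sqrt s _ _).trans ?_
  exact mul_le_of_le_one_left (Real.sqrt_nonneg _) (Real.sqrt_le_one.2 hrow)
end
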